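/- arXiv:1408.1988 — 3 statements merged into one kernel-verified Lean document; each statement's English description precedes it below -/
import Mathlib

section
/- A regular tetrahedron and a cube in ℝ³ of the same volume are equidecomposable using pieces that are Lebesgue measurable. -/
open MeasureTheory Set

noncomputable section

/-- `n`-dimensional Euclidean space `ℝⁿ`. -/
abbrev EucSp (n : ℕ) : Type := EuclideanSpace ℝ (Fin n)

/-- `A` and `B` are equidecomposable with Lebesgue measurable pieces. -/
def MeasurablyEquidecomposable (n : ℕ) (A B : Set (EucSp n)) : Prop :=
  ∃ (m : ℕ) (γ : Fin m → (EucSp n ≃ᵢ EucSp n)) (P : Fin m → Set (EucSp n)),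
    (∀ i, NullMeasurableSet (P i) volume) ∧
    (∀ i j, i ≠ j → Disjoint (P i) (P j)) ∧
    (⋃ i, P i) = A ∧
    (∀ i j, i ≠ j → Disjoint ((γ i) '' P i) ((γ j) '' P j)) ∧
    (⋃ i, (γ i) '' P i) = B

/-- `C ⊆ ℝ³` is a cube: an isometric copy of `[0, a]³` for some side length `a > 0`. -/
def IsCube (C : Set (EucSp 3)) : Prop :=
  ∃ (a : ℝ) (γ : EucSp 3 ≃ᵢ EucSp 3), 0 < a ∧
    γ '' {x : EucSp 3 | ∀ i, x i ∈ Set.Icc (0 : ℝ) a} = C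

/-- `T ⊆ ℝ³` is a regular tetrahedron: the convex hull of four pairwise equidistant points. -/
def IsRegularTetrahedron (T : Set (EucSp 3)) : Prop :=
  ∃ (p : Fin 4 → EucSp 3) (d : ℝ), 0 < d ∧
    (∀ i j, i ≠ j → dist (p i) (p j) = d) ∧
    T = convexHull ℝ (Set.range p)

section Matching

variable {X ι : Type*} [MeasurableSpace X]

/-- A measurable partial matching between `A` and `B`, encoded by the label `m x` of the map `γ i`
which sends `x` to its partner. -/
structure IsMatching (γ : ι → X ≃ᵐ X) (A B : Set X) (m : X → Option ι) : Prop where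
  measurableSet_eq : ∀ i, MeasurableSet {x | m x = some i}
  mem : ∀ {x i}, m x = some i → x ∈ A ∧ γ i x ∈ B
  inj : ∀ {x y i j}, m x = some i → m y = some j → γ i x = γ j y → x = y

/-- The points which have a partner. -/
def matchedSet (m : X → Option ι) : Set X := ⋃ i, {x | m x = some i}

/-- The partners of the points which have one. -/
def matchedImage (γ : ι → X ≃ᵐ X) (m : X → Option ι) : Set X := ⋃ i, γ i '' {x | m x = some i}

variable {γ : ι → X ≃ᵐ X} {A B : Set X} {m : X → Option ι} {μ : Measure X}

omit [MeasurableSpace X] in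
lemma mem_matchedSet {x : X} : x ∈ matchedSet m ↔ ∃ i, m x = some i := by
  simp [matchedSet]

lemma mem_matchedImage {y : X} : y ∈ matchedImage γ m ↔ ∃ i x, m x = some i ∧ γ i x = y := by
  simp [matchedImage]

lemma MeasureTheory.MeasurePreserving.measure_image_equiv {e : X ≃ᵐ X} (he : MeasurePreserving e μ μ)
    (s : Set X) : μ (e '' s) = μ s := by
  rw [← he.measure_preimage_equiv, preimage_image_eq _ e.injective]

namespace IsMatching

lemma matchedSet_subset (hm : IsMatching γ A B m) : matchedSet m ⊆ A := fun _ hx ↦ by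
  obtain ⟨i, hi⟩ := mem_matchedSet.1 hx
  exact (hm.mem hi).1

lemma matchedImage_subset (hm : IsMatching γ A B m) : matchedImage γ m ⊆ B := fun _ hx ↦ by
  obtain ⟨i, x, hi, rfl⟩ := mem_matchedImage.1 hx
  exact (hm.mem hi).2

variable [Finite ι]

lemma measurableSet_matchedSet (hm : IsMatching γ A B m) : MeasurableSet (matchedSet m) :=
  .iUnion fun i ↦ hm.measurableSet_eq i

lemma measurableSet_matchedImage (hm : IsMatching γ A B m) :
    MeasurableSet (matchedImage γ m) :=
  .iUnion fun i ↦ (γ i).measurableSet_image.2 (hm.measurableSet_eq i)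

lemma measurableSet_preimage (hm : IsMatching γ A B m) {N : Set X} (hN : MeasurableSet N) :
    MeasurableSet {x | ∃ i, m x = some i ∧ γ i x ∈ N} := by
  have : {x | ∃ i, m x = some i ∧ γ i x ∈ N} = ⋃ i, {x | m x = some i} ∩ γ i ⁻¹' N := by
    ext; simp
  rw [this]
  exact .iUnion fun i ↦ (hm.measurableSet_eq i).inter ((γ i).measurable hN)

/-- A matching preserves measure. -/
lemma measure_preimage (hm : IsMatching γ A B m) (hγ : ∀ i, MeasurePreserving (γ i) μ μ)
    {N : Set X} (hN : MeasurableSet N) :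
    μ {x | ∃ i, m x = some i ∧ γ i x ∈ N} = μ (N ∩ matchedImage γ m) := by
  have h1 : {x | ∃ i, m x = some i ∧ γ i x ∈ N} = ⋃ i, {x | m x = some i} ∩ γ i ⁻¹' N := by
    ext; simp
  have h2 : N ∩ matchedImage γ m = ⋃ i, γ i '' ({x | m x = some i} ∩ γ i ⁻¹' N) := by
    ext y
    simp only [mem_inter_iff, mem_matchedImage, mem_iUnion, mem_image, mem_ofPred_eq, mem_preimage]
    constructor
    · rintro ⟨hy, i, x, hx, rfl⟩
      exact ⟨i, x, ⟨hx, hy⟩, rfl⟩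
    · rintro ⟨i, x, ⟨hx, hy⟩, rfl⟩
      exact ⟨hy, i, x, hx, rfl⟩
  have hmeas : ∀ i, MeasurableSet ({x | m x = some i} ∩ γ i ⁻¹' N) := fun i ↦
    (hm.measurableSet_eq i).inter ((γ i).measurable hN)
  rw [h1, h2, measure_iUnion _ hmeas, measure_iUnion]
  · simp only [(hγ _).measure_image_equiv]
  · rintro i j hij
    refine Set.disjoint_left.2 ?_
    rintro _ ⟨x, ⟨hx, -⟩, rfl⟩ ⟨y, ⟨hy, -⟩, hxy⟩
    have := hm.inj hy hx hxy
    subst this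
    exact hij (Option.some_injective _ (hx.symm.trans hy))
  · exact fun i ↦ (γ i).measurableSet_image.2 (hmeas i)
  · rintro i j hij
    refine Set.disjoint_left.2 ?_
    rintro x ⟨hx, -⟩ ⟨hy, -⟩
    exact hij (Option.some_injective _ (hx.symm.trans hy))

lemma measure_matchedImage (hm : IsMatching γ A B m) (hγ : ∀ i, MeasurePreserving (γ i) μ μ) :
    μ (matchedImage γ m) = μ (matchedSet m) := by
  have := hm.measure_preimage hγ (N := univ) .univ
  simp only [mem_univ, and_true, univ_inter] at this
  rw [← this]
  congr 1
  ext
  simp [mem_matchedSet]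

end IsMatching

end Matching

section Augmentation

variable {X ι : Type*} [MeasurableSpace X]
variable {γ : ι → X ≃ᵐ X} {A B : Set X} {m : X → Option ι} {μ : Measure X}

/-- The union of the images of a set under a family of maps. -/
def spread (γ : ι → X ≃ᵐ X) (E : Set X) : Set X := ⋃ i, γ i '' E

lemma mem_spread {E : Set X} {y : X} : y ∈ spread γ E ↔ ∃ i, ∃ x ∈ E, γ i x = y := by
  simp [spread]

lemma measurableSet_spread [Finite ι] {E : Set X} (hE : MeasurableSet E) :
    MeasurableSet (spread γ E) :=
  .iUnion fun i ↦ (γ i).measurableSet_image.2 hE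

/-- The points reached from the unmatched points of `A` by alternating paths with at most `k`
steps. -/
def reach (γ : ι → X ≃ᵐ X) (A : Set X) (m : X → Option ι) : ℕ → Set X
  | 0 => A \ matchedSet m
  | k + 1 => reach γ A m k ∪ {x | ∃ i, m x = some i ∧ γ i x ∈ spread γ (reach γ A m k)}

lemma monotone_reach : Monotone (reach γ A m) :=
  monotone_nat_of_le_succ fun _ ↦ subset_union_left

lemma reach_subset (hm : IsMatching γ A B m) (k : ℕ) : reach γ A m k ⊆ A := by
  induction k with
  | zero => exact sdiff_subset
  | succ k ih =>
    rintro x (hx | ⟨i, hi, -⟩)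
    · exact ih hx
    · exact (hm.mem hi).1

lemma measurableSet_reach [Finite ι] (hA : MeasurableSet A) (hm : IsMatching γ A B m) (k : ℕ) :
    MeasurableSet (reach γ A m k) := by
  induction k with
  | zero => exact hA.diff hm.measurableSet_matchedSet
  | succ k ih => exact ih.union (hm.measurableSet_preimage (measurableSet_spread ih))

/-- The points reached by alternating paths with exactly `k` steps and not less. -/
def layer (γ : ι → X ≃ᵐ X) (A : Set X) (m : X → Option ι) : ℕ → Set X :=
  disjointed (reach γ A m)

lemma layer_zero : layer γ A m 0 = A \ matchedSet m := disjointed_zero _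

lemma layer_succ (k : ℕ) : layer γ A m (k + 1) = reach γ A m (k + 1) \ reach γ A m k :=
  monotone_reach.disjointed_succ (not_isMax k)

lemma measurableSet_layer [Finite ι] (hA : MeasurableSet A) (hm : IsMatching γ A B m) (k : ℕ) :
    MeasurableSet (layer γ A m k) :=
  .disjointed (measurableSet_reach hA hm) k

lemma exists_of_mem_layer_succ {k : ℕ} {x : X} (hx : x ∈ layer γ A m (k + 1)) :
    ∃ t s, ∃ x' ∈ layer γ A m k, m x = some t ∧ γ s x' = γ t x := by
  rw [layer_succ] at hx
  obtain ⟨hx | ⟨t, ht, hx⟩, hxk⟩ := hx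
  · exact (hxk hx).elim
  obtain ⟨s, x', hx', hs⟩ := mem_spread.1 hx
  refine ⟨t, s, x', ?_, ht, hs⟩
  cases k with
  | zero => rw [layer_zero]; exact hx'
  | succ k =>
    rw [layer_succ]
    exact ⟨hx', fun h ↦ hxk (Or.inr ⟨t, ht, mem_spread.2 ⟨s, x', h, hs⟩⟩)⟩

/-- A family of disjoint alternating paths with `k` steps, starting at the points `g 0 x` for
`x ∈ E` and following the edges `s`. -/
structure IsAltPath (γ : ι → X ≃ᵐ X) (A : Set X) (m : X → Option ι) (μ : Measure X) (k : ℕ)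
    (E : Set X) (g : ℕ → X ≃ᵐ X) (s : ℕ → ι) : Prop where
  measurableSet : MeasurableSet E
  measurePreserving : ∀ j, MeasurePreserving (g j) μ μ
  mem_layer : ∀ {j}, j ≤ k → ∀ {x}, x ∈ E → g j x ∈ layer γ A m j
  step : ∀ {j}, j < k → ∀ {x}, x ∈ E →
    ∃ t, m (g (j + 1) x) = some t ∧ γ (s j) (g j x) = γ t (g (j + 1) x)

lemma exists_isAltPath [Finite ι] [Nonempty ι] (hγ : ∀ i, MeasurePreserving (γ i) μ μ)
    (hA : MeasurableSet A) (hm : IsMatching γ A B m) (k : ℕ) {F : Set X} (hF : MeasurableSet F)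
    (hFk : F ⊆ layer γ A m k) (h0 : μ F ≠ 0) :
    ∃ E g s, IsAltPath γ A m μ k E g s ∧ μ E ≠ 0 ∧ ∀ x ∈ E, g k x ∈ F := by
  induction k generalizing F with
  | zero =>
    refine ⟨F, fun _ ↦ .refl X, fun _ ↦ Classical.arbitrary ι, ⟨hF, fun _ ↦ .id μ, ?_, by simp⟩, h0,
      fun x hx ↦ hx⟩
    intro j hj x hx
    obtain rfl : j = 0 := by omega
    exact hFk hx
  | succ k ih =>
    set D : ι × ι → Set X := fun p ↦
      F ∩ {x | m x = some p.1} ∩ γ p.1 ⁻¹' (γ p.2 '' layer γ A m k) with hD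
    have hFD : F ⊆ ⋃ p, D p := by
      intro x hx
      obtain ⟨t, s, x', hx', ht, hs⟩ := exists_of_mem_layer_succ (hFk hx)
      exact mem_iUnion.2 ⟨(t, s), ⟨hx, ht⟩, x', hx', hs⟩
    obtain ⟨⟨t, u⟩, htu⟩ : ∃ p, μ (D p) ≠ 0 := by
      by_contra! h
      exact h0 (measure_mono_null hFD (measure_iUnion_null h))
    have hDm : MeasurableSet (D (t, u)) :=
      (hF.inter (hm.measurableSet_eq t)).inter
        ((γ t).measurable ((γ u).measurableSet_image.2 (measurableSet_layer hA hm k)))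
    set e : X ≃ᵐ X := (γ u).trans (γ t).symm with he
    have hemp : MeasurePreserving e μ μ := (hγ u).trans ((hγ t).symm)
    obtain ⟨E, g, s, hE, hE0, hEF⟩ := ih (F := e ⁻¹' D (t, u)) (e.measurable hDm) (by
      rintro x ⟨-, x', hx', hxx'⟩
      have : γ u x' = γ u x := by simpa [he] using hxx'
      rwa [← (γ u).injective this]) (by rwa [hemp.measure_preimage_equiv])
    refine ⟨E, fun j ↦ if j ≤ k then g j else (g k).trans e, fun j ↦ if j < k then s j else u,
      ⟨hE.measurableSet, ?_, ?_, ?_⟩, hE0, ?_⟩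
    · intro j
      split_ifs
      · exact hE.measurePreserving j
      · exact (hE.measurePreserving k).trans hemp
    · intro j hj x hx
      split_ifs with hjk
      · exact hE.mem_layer hjk hx
      · obtain rfl : j = k + 1 := by omega
        exact hFk (hEF x hx).1.1
    · intro j hj x hx
      rcases Nat.lt_succ_iff_lt_or_eq.1 hj with hj | rfl
      · simpa [hj, hj.le, Nat.succ_le_of_lt hj] using hE.step hj hx
      · have h1 := (hEF x hx).1.2
        refine ⟨t, by simpa using h1, by simp [he]⟩
    · intro x hx
      simpa using (hEF x hx).1.1

open Classical in
/-- The matching obtained by switching along the alternating paths. -/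
def augment (m : X → Option ι) (k : ℕ) (E : Set X) (g : ℕ → X ≃ᵐ X) (s : ℕ → ι) (x : X) :
    Option ι :=
  if h : ∃ j ≤ k, x ∈ g j '' E then some (s h.choose) else m x

variable {k : ℕ} {E : Set X} {g : ℕ → X ≃ᵐ X} {s : ℕ → ι}

lemma augment_of_notMem {x : X} (h : ¬ ∃ j ≤ k, x ∈ g j '' E) : augment m k E g s x = m x :=
  dif_neg h

namespace IsAltPath

lemma eq_of_eq (h : IsAltPath γ A m μ k E g s) {i j : ℕ} (hi : i ≤ k) (hj : j ≤ k) {x y : X}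
    (hx : x ∈ E) (hy : y ∈ E) (hxy : g i x = g j y) : i = j := by
  by_contra hne
  exact Set.disjoint_left.1 (disjoint_disjointed (reach γ A m) hne) (h.mem_layer hi hx)
    (hxy ▸ h.mem_layer hj hy)

lemma augment_apply (h : IsAltPath γ A m μ k E g s) {j : ℕ} (hj : j ≤ k) {x : X} (hx : x ∈ E) :
    augment m k E g s (g j x) = some (s j) := by
  have hex : ∃ i ≤ k, g j x ∈ g i '' E := ⟨j, hj, x, hx, rfl⟩
  rw [augment, dif_pos hex]
  obtain ⟨hi, y, hy, hyx⟩ := hex.choose_spec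
  rw [h.eq_of_eq hi hj hy hx hyx]

lemma mem_set (h : IsAltPath γ A m μ k E g s) (hm : IsMatching γ A B m) {j : ℕ} (hj : j ≤ k)
    {x : X} (hx : x ∈ E) : g j x ∈ A :=
  reach_subset hm j (disjointed_subset _ _ (h.mem_layer hj hx))

lemma zero_notMem (h : IsAltPath γ A m μ k E g s) {x : X} (hx : x ∈ E) :
    g 0 x ∉ matchedSet m := by
  have := h.mem_layer (Nat.zero_le k) hx
  rw [layer_zero] at this
  exact this.2

lemma isMatching_augment [Finite ι] (h : IsAltPath γ A m μ k E g s) (hm : IsMatching γ A B m)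
    (hend : ∀ x ∈ E, γ (s k) (g k x) ∈ B \ matchedImage γ m) :
    IsMatching γ A B (augment m k E g s) := by
  have key : ∀ {j}, j ≤ k → ∀ {x}, x ∈ E → ∀ {y i}, m y = some i → γ (s j) (g j x) = γ i y →
      ∃ j' ≤ k, j' = j + 1 ∧ y ∈ g j' '' E := by
    intro j hj x hx y i hy hxy
    rcases hj.lt_or_eq with hj | rfl
    · obtain ⟨t, ht, hts⟩ := h.step hj hx
      exact ⟨j + 1, hj, rfl, x, hx, hm.inj ht hy (hts.symm.trans hxy)⟩
    · exact ((hend x hx).2 (mem_matchedImage.2 ⟨i, y, hy, hxy.symm⟩)).elim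
  refine ⟨fun i ↦ ?_, fun {x i} hx ↦ ?_, fun {x y i j} hx hy hxy ↦ ?_⟩
  · have : {x | augment m k E g s x = some i} =
        (⋃ j ∈ {j | j ≤ k ∧ s j = i}, g j '' E) ∪
          ({x | m x = some i} \ ⋃ j ∈ {j | j ≤ k}, g j '' E) := by
      ext x
      by_cases hx : ∃ j ≤ k, x ∈ g j '' E
      · obtain ⟨j, hj, y, hy, rfl⟩ := hx
        simp only [mem_ofPred_eq, h.augment_apply hj hy, mem_union, mem_iUnion, mem_sdiff,
          exists_prop]
        constructor
        · intro hji
          exact Or.inl ⟨j, ⟨hj, Option.some_injective _ hji⟩, y, hy, rfl⟩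
        · rintro (⟨j', ⟨hj', rfl⟩, z, hz, hzy⟩ | ⟨-, h'⟩)
          · rw [h.eq_of_eq hj' hj hz hy hzy]
          · exact (h' ⟨j, hj, y, hy, rfl⟩).elim
      · simp only [mem_ofPred_eq, augment_of_notMem hx, mem_union, mem_iUnion, mem_sdiff,
          exists_prop]
        constructor
        · exact fun h' ↦ Or.inr ⟨h', hx⟩
        · rintro (⟨j', ⟨hj', rfl⟩, hz⟩ | ⟨h', -⟩)
          · exact (hx ⟨j', hj', hz⟩).elim
          · exact h'
    rw [this]
    have hgE : ∀ j, MeasurableSet (g j '' E) := fun j ↦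
      (g j).measurableSet_image.2 h.measurableSet
    exact (MeasurableSet.biUnion (to_countable _) fun j _ ↦ hgE j).union
      ((hm.measurableSet_eq i).diff (MeasurableSet.biUnion (to_countable _) fun j _ ↦ hgE j))
  · by_cases hxE : ∃ j ≤ k, x ∈ g j '' E
    · obtain ⟨j, hj, y, hy, rfl⟩ := hxE
      rw [h.augment_apply hj hy] at hx
      obtain rfl := Option.some_injective _ hx
      refine ⟨h.mem_set hm hj hy, ?_⟩
      rcases hj.lt_or_eq with hj | rfl
      · obtain ⟨t, ht, hts⟩ := h.step hj hy
        rw [hts]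
        exact (hm.mem ht).2
      · exact (hend y hy).1
    · rw [augment_of_notMem hxE] at hx
      exact hm.mem hx
  · by_cases hxE : ∃ j ≤ k, x ∈ g j '' E <;> by_cases hyE : ∃ j ≤ k, y ∈ g j '' E
    · obtain ⟨p, hp, x, hxE, rfl⟩ := hxE
      obtain ⟨q, hq, y, hyE, rfl⟩ := hyE
      rw [h.augment_apply hp hxE] at hx
      rw [h.augment_apply hq hyE] at hy
      obtain rfl := Option.some_injective _ hx
      obtain rfl := Option.some_injective _ hy
      have hpq : p = q := by
        rcases hp.lt_or_eq with hp' | rfl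
        · obtain ⟨t, ht, hts⟩ := h.step hp' hxE
          obtain ⟨q', hq', rfl, z, hz, hzx⟩ := key hq hyE ht (hxy.symm.trans hts)
          have := h.eq_of_eq hq' hp' hz hxE hzx
          omega
        · rcases hq.lt_or_eq with hq' | rfl
          · obtain ⟨t, ht, hts⟩ := h.step hq' hyE
            exact ((hend x hxE).2 (mem_matchedImage.2 ⟨t, _, ht, (hxy.trans hts).symm⟩)).elim
          · rfl
      subst hpq
      exact (γ (s p)).injective hxy
    · obtain ⟨p, hp, x, hxE, rfl⟩ := hxE
      rw [h.augment_apply hp hxE] at hx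
      rw [augment_of_notMem hyE] at hy
      obtain rfl := Option.some_injective _ hx
      obtain ⟨j', hj', -, hy'⟩ := key hp hxE hy hxy
      exact (hyE ⟨j', hj', hy'⟩).elim
    · obtain ⟨q, hq, y, hyE, rfl⟩ := hyE
      rw [h.augment_apply hq hyE] at hy
      rw [augment_of_notMem hxE] at hx
      obtain rfl := Option.some_injective _ hy
      obtain ⟨j', hj', -, hy'⟩ := key hq hyE hx hxy.symm
      exact (hxE ⟨j', hj', hy'⟩).elim
    · rw [augment_of_notMem hxE] at hx
      rw [augment_of_notMem hyE] at hy
      exact hm.inj hx hy hxy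

lemma matchedSet_augment (h : IsAltPath γ A m μ k E g s) :
    matchedSet (augment m k E g s) = matchedSet m ∪ g 0 '' E := by
  ext x
  rw [mem_union, mem_matchedSet]
  by_cases hx : ∃ j ≤ k, x ∈ g j '' E
  · obtain ⟨j, hj, y, hy, rfl⟩ := hx
    refine iff_of_true ⟨_, h.augment_apply hj hy⟩ ?_
    cases j with
    | zero => exact Or.inr ⟨y, hy, rfl⟩
    | succ j =>
      obtain ⟨t, ht, -⟩ := h.step hj hy
      exact Or.inl (mem_matchedSet.2 ⟨t, ht⟩)
  · rw [augment_of_notMem hx, ← mem_matchedSet]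
    exact ⟨Or.inl, fun h' ↦ h'.resolve_right fun h'' ↦ hx ⟨0, Nat.zero_le _, h''⟩⟩

lemma measure_matchedSet_augment (h : IsAltPath γ A m μ k E g s) :
    μ (matchedSet (augment m k E g s)) = μ (matchedSet m) + μ E := by
  rw [h.matchedSet_augment, measure_union _ ((g 0).measurableSet_image.2 h.measurableSet),
    (h.measurePreserving 0).measure_image_equiv]
  refine Set.disjoint_right.2 ?_
  rintro _ ⟨x, hx, rfl⟩
  exact h.zero_notMem hx

lemma measure_augment_ne_le (h : IsAltPath γ A m μ k E g s) :
    μ {x | m x ≠ augment m k E g s x} ≤ (k + 1) * μ E := by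
  have hsub : {x | m x ≠ augment m k E g s x} ⊆ ⋃ j ∈ Finset.range (k + 1), g j '' E := by
    intro x hx
    by_contra hx'
    refine hx (augment_of_notMem ?_).symm
    rintro ⟨j, hj, hxj⟩
    exact hx' (mem_biUnion (Finset.mem_coe.2 (Finset.mem_range.2 (by omega))) hxj)
  calc
    _ ≤ ∑ j ∈ Finset.range (k + 1), μ (g j '' E) :=
      (measure_mono hsub).trans (measure_biUnion_finset_le _ _)
    _ = _ := by simp [(h.measurePreserving _).measure_image_equiv]

end IsAltPath

end Augmentation

section Improvement

variable {X ι : Type*} [MeasurableSpace X]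
variable {γ : ι → X ≃ᵐ X} {A B : Set X} {m : X → Option ι} {μ : Measure X}

lemma spread_mono {E F : Set X} (h : E ⊆ F) : spread γ E ⊆ spread γ F :=
  iUnion_mono fun _ ↦ image_mono h

lemma exists_layer_of_mem_reach {k : ℕ} {x : X} (hx : x ∈ reach γ A m k) :
    ∃ j ≤ k, x ∈ layer γ A m j := by
  induction k with
  | zero => exact ⟨0, le_rfl, by rwa [layer_zero]⟩
  | succ k ih =>
    by_cases h : x ∈ reach γ A m k
    · obtain ⟨j, hj, hxj⟩ := ih h
      exact ⟨j, by omega, hxj⟩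
    · exact ⟨k + 1, le_rfl, by rw [layer_succ]; exact ⟨hx, h⟩⟩

/-- The measured bipartite graph between `A` and `B` whose edges are given by `γ` is expanding. -/
structure IsExpanding (γ : ι → X ≃ᵐ X) (A B : Set X) (μ : Measure X) : Prop where
  measurePreserving : ∀ i, MeasurePreserving (γ i) μ μ
  measurableSet_left : MeasurableSet A
  measurableSet_right : MeasurableSet B
  measure_eq : μ B = μ A
  measure_ne_top : μ A ≠ ⊤
  le_left : ∀ E ⊆ A, MeasurableSet E →
    min (2 * μ.real E) (2 / 3 * μ.real A) ≤ μ.real (spread γ E ∩ B)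
  le_right : ∀ F ⊆ B, MeasurableSet F →
    min (2 * μ.real F) (2 / 3 * μ.real A) ≤ μ.real (A ∩ ⋃ i, γ i ⁻¹' F)

namespace IsExpanding

lemma measure_ne_top_right (h : IsExpanding γ A B μ) : μ B ≠ ⊤ := h.measure_eq ▸ h.measure_ne_top

lemma measureReal_unmatched_right [Finite ι] (h : IsExpanding γ A B μ) (hm : IsMatching γ A B m) :
    μ.real (B \ matchedImage γ m) = μ.real (A \ matchedSet m) := by
  rw [measureReal_sdiff hm.matchedImage_subset hm.measurableSet_matchedImage
      h.measure_ne_top_right,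
    measureReal_sdiff hm.matchedSet_subset hm.measurableSet_matchedSet
      h.measure_ne_top]
  simp only [Measure.real, hm.measure_matchedImage h.measurePreserving, h.measure_eq]

/-- Some alternating paths of controlled length reach unmatched points. -/
lemma exists_reach_unmatched [Finite ι] (h : IsExpanding γ A B μ) (hm : IsMatching γ A B m)
    (hu : 0 < μ.real (A \ matchedSet m)) {K : ℕ}
    (hK : μ.real A ≤ 2 ^ K * μ.real (A \ matchedSet m)) :
    ∃ j ≤ 2 * K, μ (spread γ (reach γ A m j) ∩ (B \ matchedImage γ m)) ≠ 0 := by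
  by_contra! hcon
  have hAt := h.measure_ne_top
  have hBt := h.measure_ne_top_right
  set a := μ.real A with ha
  set u := μ.real (A \ matchedSet m) with hu'
  have hRA := reach_subset hm
  have hRt : ∀ j, μ (reach γ A m j) ≠ ⊤ := fun j ↦ measure_ne_top_of_subset (hRA j) hAt
  have hRm : ∀ j, MeasurableSet (reach γ A m j) := measurableSet_reach h.measurableSet_left hm
  have hSm : ∀ j, MeasurableSet (spread γ (reach γ A m j)) := fun j ↦ measurableSet_spread (hRm j)
  have hua : u ≤ a := measureReal_mono sdiff_subset hAt
  have hstep : ∀ j ≤ 2 * K, μ.real (spread γ (reach γ A m j) ∩ B) ≤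
      μ.real (reach γ A m (j + 1)) := by
    intro j hj
    refine ENNReal.toReal_mono (hRt _) ?_
    calc μ (spread γ (reach γ A m j) ∩ B)
        ≤ μ ((spread γ (reach γ A m j) ∩ matchedImage γ m) ∪
          (spread γ (reach γ A m j) ∩ (B \ matchedImage γ m))) := by
          refine measure_mono ?_
          rintro x ⟨hx, hxB⟩
          by_cases hxm : x ∈ matchedImage γ m
          · exact Or.inl ⟨hx, hxm⟩
          · exact Or.inr ⟨hx, hxB, hxm⟩
      _ ≤ μ (spread γ (reach γ A m j) ∩ matchedImage γ m) + 0 :=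
          (measure_union_le _ _).trans (by rw [hcon j hj])
      _ = μ {x | ∃ i, m x = some i ∧ γ i x ∈ spread γ (reach γ A m j)} := by
          rw [add_zero, hm.measure_preimage h.measurePreserving (hSm j)]
      _ ≤ _ := measure_mono subset_union_right
  have hgrow : ∀ j ≤ 2 * K, min (2 ^ j * u) (2 / 3 * a) ≤ μ.real (reach γ A m j) := by
    intro j
    induction j with
    | zero => exact fun _ ↦ by simp [reach, hu']
    | succ j ih =>
      intro hj
      have h1 := h.le_left _ (hRA j) (hRm j)
      have h2 := hstep j (by omega)
      have h3 := ih (by omega)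
      rw [pow_succ]
      rcases le_total (2 ^ j * u) (2 / 3 * a) with h4 | h4
      · rw [min_eq_left h4] at h3
        refine le_trans (le_min ?_ (min_le_right _ _)) (h1.trans h2)
        exact (min_le_left _ _).trans (by linarith)
      · rw [min_eq_right h4] at h3
        refine le_trans (le_min ?_ (min_le_right _ _)) (h1.trans h2)
        exact (min_le_right _ _).trans (by linarith)
  have hV : ∀ j, μ.real (B \ spread γ (reach γ A m j)) =
      a - μ.real (spread γ (reach γ A m j) ∩ B) := by
    intro j
    have := measureReal_inter_add_sdiff (μ := μ) (s := B) (hSm j) hBt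
    rw [inter_comm] at this
    have hab : μ.real B = a := by rw [ha, Measure.real, Measure.real, h.measure_eq]
    linarith
  have hVK : ∀ j, K ≤ j → μ.real (B \ spread γ (reach γ A m j)) ≤ a / 3 := by
    intro j hj
    have h1 := hgrow K (by omega)
    rw [min_eq_right (by linarith)] at h1
    have h2 := h.le_left _ (hRA K) (hRm K)
    rw [min_eq_right (by linarith)] at h2
    have h3 : μ.real (B \ spread γ (reach γ A m j)) ≤ μ.real (B \ spread γ (reach γ A m K)) :=
      measureReal_mono (sdiff_subset_sdiff_right (spread_mono (monotone_reach hj)))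
        (measure_ne_top_of_subset sdiff_subset hBt)
    rw [hV K] at h3
    linarith
  have hdecay : ∀ i ≤ K, 2 ^ i * μ.real (B \ spread γ (reach γ A m (K + i))) ≤ a / 3 := by
    intro i
    induction i with
    | zero => exact fun _ ↦ by simpa using hVK K le_rfl
    | succ i ih =>
      intro hi
      have h1 := ih (by omega)
      have h2 := h.le_right (B \ spread γ (reach γ A m (K + i + 1))) sdiff_subset
        (h.measurableSet_right.diff (hSm _))
      have h3 := hVK (K + i + 1) (by omega)
      rw [min_eq_left (by linarith)] at h2
      have h4 : μ.real (A ∩ ⋃ s, γ s ⁻¹' (B \ spread γ (reach γ A m (K + i + 1)))) ≤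
          μ.real (A \ reach γ A m (K + i + 1)) := by
        refine measureReal_mono ?_ (measure_ne_top_of_subset sdiff_subset hAt)
        rintro x ⟨hxA, hx⟩
        obtain ⟨s, hs⟩ := mem_iUnion.1 hx
        exact ⟨hxA, fun hxR ↦ hs.2 (mem_spread.2 ⟨s, x, hxR, rfl⟩)⟩
      rw [measureReal_sdiff (hRA _) (hRm _) hAt] at h4
      have h5 := hstep (K + i) (by omega)
      have h6 := hV (K + i)
      have h7 : 2 * μ.real (B \ spread γ (reach γ A m (K + i + 1))) ≤
          μ.real (B \ spread γ (reach γ A m (K + i))) := by linarith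
      calc 2 ^ (i + 1) * μ.real (B \ spread γ (reach γ A m (K + (i + 1))))
          = 2 ^ i * (2 * μ.real (B \ spread γ (reach γ A m (K + i + 1)))) := by
            rw [pow_succ, mul_assoc, add_assoc]
        _ ≤ _ := (mul_le_mul_of_nonneg_left h7 (by positivity)).trans h1
  have hlow : u ≤ μ.real (B \ spread γ (reach γ A m (K + K))) := by
    rw [hu', ← h.measureReal_unmatched_right hm]
    refine ENNReal.toReal_mono (measure_ne_top_of_subset sdiff_subset hBt) ?_
    calc μ (B \ matchedImage γ m)
        ≤ μ ((B \ spread γ (reach γ A m (K + K))) ∪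
          (spread γ (reach γ A m (K + K)) ∩ (B \ matchedImage γ m))) := by
          refine measure_mono ?_
          intro x hx
          by_cases hxs : x ∈ spread γ (reach γ A m (K + K))
          · exact Or.inr ⟨hxs, hx⟩
          · exact Or.inl ⟨hx.1, hxs⟩
      _ ≤ _ := (measure_union_le _ _).trans (by rw [hcon (K + K) (by omega), add_zero])
  have h1 := hdecay K le_rfl
  have h2 : (2 : ℝ) ^ K * u ≤ 2 ^ K * μ.real (B \ spread γ (reach γ A m (K + K))) := by gcongr
  linarith

lemma exists_augment [Finite ι] (h : IsExpanding γ A B μ) (hm : IsMatching γ A B m)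
    (hu : 0 < μ.real (A \ matchedSet m)) {K : ℕ}
    (hK : μ.real A ≤ 2 ^ K * μ.real (A \ matchedSet m)) :
    ∃ m', IsMatching γ A B m' ∧ μ.real (A \ matchedSet m') < μ.real (A \ matchedSet m) ∧
      μ.real {x | m x ≠ m' x} ≤
        (2 * K + 1) * (μ.real (A \ matchedSet m) - μ.real (A \ matchedSet m')) := by
  obtain ⟨j, hjK, hj⟩ := h.exists_reach_unmatched hm hu hK
  set W := B \ matchedImage γ m with hW
  have hWm : MeasurableSet W := h.measurableSet_right.diff hm.measurableSet_matchedImage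
  have hsub : spread γ (reach γ A m j) ∩ W ⊆
      ⋃ i ∈ Finset.range (j + 1), ⋃ s, γ s '' (layer γ A m i ∩ γ s ⁻¹' W) := by
    rintro y ⟨hy, hyW⟩
    obtain ⟨s, x, hx, rfl⟩ := mem_spread.1 hy
    obtain ⟨i, hi, hxi⟩ := exists_layer_of_mem_reach hx
    simp only [mem_iUnion]
    exact ⟨i, Finset.mem_range.2 (by omega), s, x, ⟨hxi, hyW⟩, rfl⟩
  obtain ⟨i, hi, s, hs⟩ : ∃ i ≤ j, ∃ s, μ (layer γ A m i ∩ γ s ⁻¹' W) ≠ 0 := by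
    by_contra! hcon
    refine hj (measure_mono_null hsub ?_)
    refine (measure_biUnion_null_iff (Finset.countable_toSet _)).2 fun i hi ↦ ?_
    refine measure_iUnion_null fun s ↦ ?_
    rw [(h.measurePreserving s).measure_image_equiv]
    exact hcon i (by simpa [Nat.lt_succ_iff] using hi) s
  have : Nonempty ι := ⟨s⟩
  obtain ⟨E, g, t, hE, hE0, hEF⟩ := exists_isAltPath h.measurePreserving h.measurableSet_left hm i
    ((measurableSet_layer h.measurableSet_left hm i).inter ((γ s).measurable hWm))
    inter_subset_left hs
  have hE' : IsAltPath γ A m μ i E g (Function.update t i s) := by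
    refine ⟨hE.measurableSet, hE.measurePreserving, hE.mem_layer, fun {j} hj {x} hx ↦ ?_⟩
    simpa [hj.ne] using hE.step hj hx
  have hm' : IsMatching γ A B (augment m i E g (Function.update t i s)) :=
    hE'.isMatching_augment hm fun x hx ↦ by simpa [hW] using (hEF x hx).2
  have hEt : μ E ≠ ⊤ := by
    rw [← (hE'.measurePreserving 0).measure_image_equiv]
    refine measure_ne_top_of_subset ?_ h.measure_ne_top
    rintro _ ⟨x, hx, rfl⟩
    exact hE'.mem_set hm (Nat.zero_le _) hx
  have hEpos : 0 < μ.real E := ENNReal.toReal_pos hE0 hEt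
  have hmt := measure_ne_top_of_subset hm.matchedSet_subset h.measure_ne_top
  have hdiff : μ.real (A \ matchedSet (augment m i E g (Function.update t i s))) =
      μ.real (A \ matchedSet m) - μ.real E := by
    rw [measureReal_sdiff hm'.matchedSet_subset hm'.measurableSet_matchedSet
        h.measure_ne_top,
      measureReal_sdiff hm.matchedSet_subset hm.measurableSet_matchedSet h.measure_ne_top]
    rw [Measure.real, Measure.real, hE'.measure_matchedSet_augment, ENNReal.toReal_add hmt hEt]
    simp only [Measure.real]
    ring
  refine ⟨_, hm', by linarith, ?_⟩
  rw [hdiff, sub_sub_cancel]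
  have h1 := ENNReal.toReal_mono (ENNReal.mul_ne_top (by norm_cast; exact ENNReal.natCast_ne_top _) hEt)
    hE'.measure_augment_ne_le
  rw [ENNReal.toReal_mul] at h1
  refine h1.trans ?_
  have h2 : ((i : ENNReal) + 1).toReal = i + 1 := by
    rw [ENNReal.toReal_add (by simp) (by simp)]; simp
  rw [h2]
  have : (i : ℝ) ≤ 2 * K := by exact_mod_cast hi.trans hjK
  change _ * μ.real E ≤ _
  gcongr

/-- An imperfect matching can be improved, at a cost controlled by the square root of the measure
of the set of unmatched points. -/
lemma exists_improvement [Finite ι] (h : IsExpanding γ A B μ) (hm : IsMatching γ A B m)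
    (hu : 0 < μ.real (A \ matchedSet m)) :
    ∃ m', IsMatching γ A B m' ∧ μ.real (A \ matchedSet m') < μ.real (A \ matchedSet m) ∧
      μ.real {x | m x ≠ m' x} ≤
        18 * √(μ.real A) * (√(μ.real (A \ matchedSet m)) - √(μ.real (A \ matchedSet m'))) := by
  set a := μ.real A with ha
  set u := μ.real (A \ matchedSet m) with hu'
  have hua : u ≤ a := measureReal_mono sdiff_subset h.measure_ne_top
  have hsu : 0 < √u := Real.sqrt_pos.2 hu
  have hsa : √u ≤ √a := Real.sqrt_le_sqrt hua
  have hsu2 : √u ^ 2 = u := Real.sq_sqrt hu.le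
  have hsa2 : √a ^ 2 = a := Real.sq_sqrt (hu.le.trans hua)
  set n := ⌈√a / √u⌉₊ with hn
  have hn1 : √a ≤ n * √u := by
    rw [← div_le_iff₀ hsu]
    exact Nat.le_ceil _
  have hn2 : n * √u ≤ √a + √u := by
    have := (Nat.ceil_lt_add_one (show 0 ≤ √a / √u by positivity)).le
    calc n * √u ≤ (√a / √u + 1) * √u := by gcongr
      _ = _ := by field_simp
  obtain ⟨m', hm', hlt, hle⟩ := h.exists_augment hm hu (K := 2 * n) (by
    have h2n : (n : ℝ) ≤ 2 ^ n := by exact_mod_cast Nat.lt_two_pow_self.le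
    calc a = √a ^ 2 := hsa2.symm
      _ ≤ (n * √u) ^ 2 := by gcongr
      _ = (n : ℝ) ^ 2 * u := by rw [mul_pow, hsu2]
      _ ≤ (2 ^ n) ^ 2 * u := by gcongr
      _ = 2 ^ (2 * n) * u := by rw [← pow_mul, mul_comm n])
  refine ⟨m', hm', hlt, hle.trans ?_⟩
  set u' := μ.real (A \ matchedSet m')
  have hu'0 : 0 ≤ u' := measureReal_nonneg
  have hs' : √u' ≤ √u := Real.sqrt_le_sqrt hlt.le
  have hs'0 : 0 ≤ √u' := Real.sqrt_nonneg _
  have hsu'2 : √u' ^ 2 = u' := Real.sq_sqrt hu'0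
  have h1 : u - u' = (√u - √u') * (√u + √u') := by
    linear_combination hsu'2 - hsu2
  rw [h1]
  push_cast
  have h2 : (2 * (2 * (n : ℝ)) + 1) * (√u + √u') ≤ 18 * √a := by
    have : √u + √u' ≤ 2 * √u := by linarith
    calc (2 * (2 * (n : ℝ)) + 1) * (√u + √u') ≤ (2 * (2 * (n : ℝ)) + 1) * (2 * √u) := by gcongr
      _ = 8 * (n * √u) + 2 * √u := by ring
      _ ≤ _ := by linarith
  calc _ = ((2 * (2 * (n : ℝ)) + 1) * (√u + √u')) * (√u - √u') := by ring
    _ ≤ _ := by gcongr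

end IsExpanding

end Improvement

section Limit

variable {X ι : Type*} [MeasurableSpace X] {γ : ι → X ≃ᵐ X} {A B : Set X} {μ : Measure X}

open Classical in
/-- The pointwise limit of a sequence of partial matchings, undefined at the points where the
sequence is not eventually constant. -/
def limitMatching (m : ℕ → X → Option ι) (x : X) : Option ι :=
  if h : ∃ i n, ∀ k ≥ n, m k x = some i then some h.choose else none

omit [MeasurableSpace X] in
lemma limitMatching_eq_some {m : ℕ → X → Option ι} {x : X} {i : ι} :
    limitMatching m x = some i ↔ ∃ n, ∀ k ≥ n, m k x = some i := by
  unfold limitMatching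
  split_ifs with h
  · obtain ⟨n, hn⟩ := h.choose_spec
    constructor
    · rintro hi
      exact ⟨n, by rwa [hi] at hn⟩
    · rintro ⟨n', hn'⟩
      rw [← hn' _ (le_max_left n' n), hn _ (le_max_right n' n)]
  · simp only [false_iff]
    exact fun hi ↦ h ⟨i, hi⟩

lemma isMatching_limitMatching {m : ℕ → X → Option ι} (hm : ∀ n, IsMatching γ A B (m n)) :
    IsMatching γ A B (limitMatching m) where
  measurableSet_eq i := by
    have : {x | limitMatching m x = some i} = ⋃ n, ⋂ k, ⋂ (_ : k ≥ n), {x | m k x = some i} := by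
      ext; simp [limitMatching_eq_some]
    rw [this]
    exact .iUnion fun n ↦ .iInter fun k ↦ .iInter fun _ ↦ (hm k).measurableSet_eq i
  mem h := by
    obtain ⟨n, hn⟩ := limitMatching_eq_some.1 h
    exact (hm n).mem (hn n le_rfl)
  inj {x y i j} hx hy h := by
    obtain ⟨n, hn⟩ := limitMatching_eq_some.1 hx
    obtain ⟨n', hn'⟩ := limitMatching_eq_some.1 hy
    exact (hm (max n n')).inj (hn _ (le_max_left _ _)) (hn' _ (le_max_right _ _)) h

omit [MeasurableSpace X] in
lemma ne_limitMatching_subset (m : ℕ → X → Option ι) (n : ℕ) :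
    {x | m n x ≠ limitMatching m x} ⊆ ⋃ k, {x | m (n + k) x ≠ m (n + k + 1) x} := by
  intro x hx
  by_contra h
  simp only [mem_iUnion, Set.mem_ofPred_eq, not_exists, not_not] at h hx
  have h' : ∀ k, m (n + k) x = m n x := fun k ↦ by
    induction k with
    | zero => rfl
    | succ k ih => rw [← ih, h k]; rfl
  apply hx
  rcases hi : limitMatching m x with _ | i
  · rcases hj : m n x with _ | j
    · rfl
    · have : limitMatching m x = some j := limitMatching_eq_some.2 ⟨n, fun k hk ↦ by
        obtain ⟨k, rfl⟩ := Nat.exists_eq_add_of_le hk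
        rw [h', hj]⟩
      simp [hi] at this
  · obtain ⟨k, hk⟩ := limitMatching_eq_some.1 hi
    rw [← h' k, hk _ (by lia)]

namespace IsMatching

variable {m m' m'' : X → Option ι}

lemma measure_ne_lt_top (hA : μ A ≠ ⊤) (hm : IsMatching γ A B m) (hm' : IsMatching γ A B m') :
    μ {x | m x ≠ m' x} ≠ ⊤ := by
  refine ne_top_of_le_ne_top hA (measure_mono fun x hx ↦ ?_)
  rcases h : m x with _ | i
  · rcases h' : m' x with _ | i
    · simp [h, h'] at hx
    · exact (hm'.mem h').1
  · exact (hm.mem h).1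

lemma measureReal_ne_triangle (hA : μ A ≠ ⊤) (hm : IsMatching γ A B m) (hm' : IsMatching γ A B m')
    (hm'' : IsMatching γ A B m'') :
    μ.real {x | m x ≠ m'' x} ≤ μ.real {x | m x ≠ m' x} + μ.real {x | m' x ≠ m'' x} := by
  refine (measureReal_mono ?_ ?_).trans (measureReal_union_le _ _)
  · intro x hx
    by_contra h
    simp only [mem_union, Set.mem_ofPred_eq, not_or, not_not] at h hx
    exact hx (h.1.trans h.2)
  · exact (measure_union_lt_top (hm.measure_ne_lt_top hA hm').lt_top
      (hm'.measure_ne_lt_top hA hm'').lt_top).ne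

lemma measureReal_unmatched_le (hA : μ A ≠ ⊤) (hm : IsMatching γ A B m)
    (hm' : IsMatching γ A B m') :
    μ.real (A \ matchedSet m') ≤ μ.real (A \ matchedSet m) + μ.real {x | m x ≠ m' x} := by
  refine (measureReal_mono ?_ ?_).trans (measureReal_union_le _ _)
  · rintro x ⟨hx, hx'⟩
    by_cases h : m x = m' x
    · left
      refine ⟨hx, ?_⟩
      rw [mem_matchedSet] at hx' ⊢
      rwa [h]
    · exact Or.inr h
  · exact (measure_union_lt_top ((measure_mono sdiff_subset).trans_lt hA.lt_top)
      (hm.measure_ne_lt_top hA hm').lt_top).ne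

end IsMatching

/-- If `c` is a nonnegative cost and every step of a sequence of matchings is small compared to the
decrease of the cost, so is the passage to the limit. -/
lemma measureReal_ne_limitMatching_le (hA : μ A ≠ ⊤) {m : ℕ → X → Option ι}
    (hm : ∀ n, IsMatching γ A B (m n)) {c : ℕ → ℝ} {l : ℝ} (hl : ∀ n, l ≤ c n)
    (h : ∀ n, μ.real {x | m n x ≠ m (n + 1) x} ≤ c n - c (n + 1)) (n : ℕ) :
    μ.real {x | m n x ≠ limitMatching m x} ≤ c n - l := by
  refine ENNReal.toReal_le_of_le_ofReal (by linarith [hl n]) ?_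
  refine (measure_mono (ne_limitMatching_subset m n)).trans ((measure_iUnion_le _).trans ?_)
  refine ENNReal.tsum_le_of_sum_range_le fun N ↦ ?_
  have h1 : ∀ k, μ {x | m (n + k) x ≠ m (n + k + 1) x} =
      ENNReal.ofReal (μ.real {x | m (n + k) x ≠ m (n + k + 1) x}) := fun k ↦
    (ENNReal.ofReal_toReal ((hm _).measure_ne_lt_top hA (hm _))).symm
  simp only [h1]
  rw [← ENNReal.ofReal_sum_of_nonneg fun _ _ ↦ measureReal_nonneg]
  refine ENNReal.ofReal_le_ofReal ?_
  have h2 : ∀ N, ∑ k ∈ Finset.range N, μ.real {x | m (n + k) x ≠ m (n + k + 1) x} ≤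
      c n - c (n + N) := fun N ↦ by
    induction N with
    | zero => simp
    | succ N ih =>
      rw [Finset.sum_range_succ]
      have := h (n + N)
      rw [← add_assoc]
      linarith
  linarith [h2 N, hl (n + N)]

/-- An expanding family of maps matches almost every point of `A` with almost every point
of `B`. -/
theorem IsExpanding.exists_matching [Finite ι] (h : IsExpanding γ A B μ) :
    ∃ m, IsMatching γ A B m ∧ μ.real (A \ matchedSet m) = 0 := by
  have hA := h.measure_ne_top
  set u : (X → Option ι) → ℝ := fun m ↦ μ.real (A \ matchedSet m) with hu
  set c : (X → Option ι) → ℝ := fun m ↦ 18 * √(μ.real A) * √(u m) with hc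
  have hc0 : ∀ m, 0 ≤ c m := fun m ↦ by positivity
  set better : (X → Option ι) → (X → Option ι) → Prop := fun m m' ↦
    IsMatching γ A B m' ∧ μ.real {x | m x ≠ m' x} ≤ c m - c m' with hbetter
  have bdd : ∀ m, BddBelow (c '' {m' | better m m'}) := fun m ↦
    ⟨0, by rintro _ ⟨m', -, rfl⟩; exact hc0 m'⟩
  have hstep : ∀ m : {m // IsMatching γ A B m}, ∃ m' : {m // IsMatching γ A B m},
      better m m' ∧ ∀ m'', better m m'' → c m' ≤ (c m + c m'') / 2 := by
    rintro ⟨m, hm⟩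
    have hself : better m m := ⟨hm, by simp⟩
    set I := sInf (c '' {m' | better m m'}) with hI
    have hIm : I ≤ c m := csInf_le (bdd m) ⟨m, hself, rfl⟩
    rcases hIm.eq_or_lt with hI' | hI'
    · refine ⟨⟨m, hm⟩, hself, fun m'' hm'' ↦ ?_⟩
      have : I ≤ c m'' := csInf_le (bdd m) ⟨m'', hm'', rfl⟩
      simp only
      linarith
    · obtain ⟨_, ⟨m', hm', rfl⟩, hlt⟩ := exists_lt_of_csInf_lt (s := c '' {m' | better m m'})
        ⟨_, m, hself, rfl⟩ (b := (c m + I) / 2) (by linarith)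
      refine ⟨⟨m', hm'.1⟩, hm', fun m'' hm'' ↦ ?_⟩
      have : I ≤ c m'' := csInf_le (bdd m) ⟨m'', hm'', rfl⟩
      simp only
      linarith
  choose next hnext hopt using hstep
  have hnone : IsMatching γ A B (fun _ ↦ none) := ⟨by simp, by simp, by simp⟩
  set s : ℕ → {m // IsMatching γ A B m} := fun n ↦ next^[n] ⟨_, hnone⟩ with hs
  have hs1 : ∀ n, s (n + 1) = next (s n) := fun n ↦ Function.iterate_succ_apply' _ _ _
  set m : ℕ → X → Option ι := fun n ↦ (s n).1 with hm
  have hmm : ∀ n, IsMatching γ A B (m n) := fun n ↦ (s n).2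
  have hdist : ∀ n, μ.real {x | m n x ≠ m (n + 1) x} ≤ c (m n) - c (m (n + 1)) := fun n ↦ by
    simpa only [hm, hs1] using (hnext (s n)).2
  have hanti : Antitone fun n ↦ c (m n) := antitone_nat_of_succ_le fun n ↦ by
    linarith [hdist n, measureReal_nonneg (μ := μ) (s := {x | m n x ≠ m (n + 1) x})]
  have hbdd : BddBelow (range fun n ↦ c (m n)) := ⟨0, by rintro _ ⟨n, rfl⟩; exact hc0 _⟩
  set l := ⨅ n, c (m n) with hl
  have hln : ∀ n, l ≤ c (m n) := fun n ↦ ciInf_le hbdd n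
  have hlim : Filter.Tendsto (fun n ↦ c (m n)) .atTop (nhds l) := tendsto_atTop_ciInf hanti hbdd
  set w := limitMatching m
  have hw : IsMatching γ A B w := isMatching_limitMatching hmm
  have hmw : ∀ n, μ.real {x | m n x ≠ w x} ≤ c (m n) - l :=
    measureReal_ne_limitMatching_le hA hmm hln hdist
  have hcw : c w ≤ l := by
    have h0 : Filter.Tendsto (fun n ↦ 18 * √(μ.real A) * √(u w - (c (m n) - l))) .atTop
        (nhds (c w)) := by
      have h1 : Filter.Tendsto (fun n ↦ u w - (c (m n) - l)) .atTop (nhds (u w - (l - l))) :=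
        tendsto_const_nhds.sub (hlim.sub_const l)
      rw [sub_self, sub_zero] at h1
      exact ((Real.continuous_sqrt.tendsto _).comp h1).const_mul _
    refine le_of_tendsto_of_tendsto' h0 hlim fun n ↦ ?_
    have := (hmm n).measureReal_unmatched_le hA hw
    have h2 := hmw n
    have h3 : u w - (c (m n) - l) ≤ u (m n) := by simp only [hu]; linarith
    simp only [hc]
    gcongr
  have hbw : ∀ n, better (m n) w := fun n ↦ ⟨hw, by linarith [hmw n]⟩
  refine ⟨w, hw, ?_⟩
  by_contra hne
  obtain ⟨w', hw', hlt, hd⟩ := h.exists_improvement hw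
    (lt_of_le_of_ne measureReal_nonneg (Ne.symm hne))
  have hcw' : c w' < c w := by
    have hupos : 0 < u w := lt_of_le_of_ne measureReal_nonneg (Ne.symm hne)
    have : 0 < μ.real A := hupos.trans_le (measureReal_mono sdiff_subset hA)
    have h1 : √(u w') < √(u w) := Real.sqrt_lt_sqrt measureReal_nonneg hlt
    have h2 : 0 < √(μ.real A) := Real.sqrt_pos.2 this
    simp only [hc]
    gcongr
  have hb' : ∀ n, better (m n) w' := fun n ↦ ⟨hw', by
    have h1 := (hmm n).measureReal_ne_triangle hA hw hw'
    have h2 := (hbw n).2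
    have h3 : μ.real {x | w x ≠ w' x} ≤ c w - c w' := by
      simp only [hc]
      rw [← mul_sub]
      exact hd
    linarith⟩
  have hopt' : ∀ n, l ≤ (c (m n) + c w') / 2 := fun n ↦ by
    have := hopt (s n) w' (hb' n)
    rw [← hs1] at this
    exact (hln (n + 1)).trans this
  have : l ≤ (l + c w') / 2 :=
    ge_of_tendsto' ((hlim.add_const _).div_const 2) hopt'
  linarith

end Limit

section Turn

/-- Six integer vectors of squared length `5`. -/
def axisVec : Fin 6 → Fin 3 → ℤ :=
  ![![1, 2, 0], ![1, -2, 0], ![0, 1, 2], ![0, 1, -2], ![2, 0, 1], ![-2, 0, 1]]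

/-- The matrix of the half-turn about the axis `axisVec i`, multiplied by `5`. -/
def turnMatrix (i : Fin 6) (j l : Fin 3) : ℤ :=
  2 * axisVec i j * axisVec i l - if j = l then 5 else 0

/-- The action of `turnMatrix i` on the vectors with entries in an abelian group. -/
def turn {G : Type*} [AddCommGroup G] (i : Fin 6) : (Fin 3 → G) →+ (Fin 3 → G) where
  toFun x j := ∑ l, turnMatrix i j l • x l
  map_zero' := by ext; simp
  map_add' x y := by ext; simp [Finset.sum_add_distrib]

lemma turn_apply {G : Type*} [AddCommGroup G] (i : Fin 6) (x : Fin 3 → G) (j : Fin 3) :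
    turn i x j = ∑ l, turnMatrix i j l • x l := rfl

lemma turnMatrix_symm (i : Fin 6) (j l : Fin 3) : turnMatrix i j l = turnMatrix i l j := by
  revert i j l; decide

lemma sum_turnMatrix_mul (i : Fin 6) (j p : Fin 3) :
    ∑ l, turnMatrix i j l * turnMatrix i l p = if j = p then 25 else 0 := by
  revert i j p; decide

lemma turn_turn {G : Type*} [AddCommGroup G] (i : Fin 6) (x : Fin 3 → G) :
    turn i (turn i x) = (25 : ℤ) • x := by
  ext j
  simp only [turn_apply, Finset.smul_sum, smul_smul]
  rw [Finset.sum_comm]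
  simp only [← Finset.sum_smul, sum_turnMatrix_mul, ite_smul, zero_smul, Finset.sum_ite_eq,
    Finset.mem_univ, if_true, Pi.smul_apply]

lemma turn_int (i : Fin 6) (k : Fin 3 → ℤ) :
    turn i k = (2 * (axisVec i ⬝ᵥ k)) • axisVec i - (5 : ℤ) • k := by
  ext j
  simp only [turn_apply, turnMatrix, smul_eq_mul, sub_mul, ite_mul, zero_mul,
    Finset.sum_sub_distrib, Finset.sum_ite_eq, Finset.mem_univ, if_true, Pi.sub_apply,
    Pi.smul_apply, dotProduct, Finset.mul_sum, Finset.sum_mul]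
  congr 1
  exact Finset.sum_congr rfl fun l _ ↦ by ring

end Turn

section Residue

/-- The reduction of an integer vector modulo `5`. -/
def mod5 (k : Fin 3 → ℤ) : Fin 3 → ZMod 5 := fun j ↦ (k j : ZMod 5)

lemma mod5_smul (a : ℤ) (k : Fin 3 → ℤ) : mod5 (a • k) = (a : ZMod 5) • mod5 k := by
  ext; simp [mod5]

lemma mod5_eq_zero {k : Fin 3 → ℤ} : mod5 k = 0 ↔ ∃ l, k = (5 : ℤ) • l := by
  constructor
  · intro h
    have : ∀ j, (5 : ℤ) ∣ k j := fun j ↦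
      (ZMod.intCast_zmod_eq_zero_iff_dvd (k j) 5).1 (congrFun h j)
    choose l hl using this
    exact ⟨l, funext hl⟩
  · rintro ⟨l, rfl⟩
    rw [mod5_smul, show ((5 : ℤ) : ZMod 5) = 0 by decide, zero_smul]

instance : Fact (Nat.Prime 5) := ⟨by norm_num⟩

lemma exists_eq_pow_smul {k : Fin 3 → ℤ} (hk : k ≠ 0) :
    ∃ (v : ℕ) (k₀ : Fin 3 → ℤ), k = (5 : ℤ) ^ v • k₀ ∧ mod5 k₀ ≠ 0 := by
  have key : ∀ (N : ℕ) (k : Fin 3 → ℤ), k ≠ 0 → ∑ j, (k j).natAbs ≤ N →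
      ∃ (v : ℕ) (k₀ : Fin 3 → ℤ), k = (5 : ℤ) ^ v • k₀ ∧ mod5 k₀ ≠ 0 := by
    intro N
    induction N with
    | zero =>
      intro k hk hN
      exact absurd (funext fun j ↦ by
        have := (Finset.sum_eq_zero_iff.1 (Nat.le_zero.1 hN)) j (Finset.mem_univ _)
        simpa using this) hk
    | succ N ih =>
      intro k hk hN
      by_cases h : mod5 k = 0
      · obtain ⟨l, rfl⟩ := mod5_eq_zero.1 h
        have hl : l ≠ 0 := fun h ↦ hk (by simp [h])
        have hsum : ∑ j, (((5 : ℤ) • l) j).natAbs = 5 * ∑ j, (l j).natAbs := by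
          simp [Finset.mul_sum, Int.natAbs_mul]
        obtain ⟨v, k₀, h1, h2⟩ := ih l hl (by lia)
        exact ⟨v + 1, k₀, by rw [h1, smul_smul, pow_succ'], h2⟩
      · exact ⟨0, k, by simp, h⟩
  exact key _ k hk le_rfl

lemma eq_of_pow_smul_eq {v w : ℕ} {k l : Fin 3 → ℤ} (hk : mod5 k ≠ 0) (hl : mod5 l ≠ 0)
    (h : (5 : ℤ) ^ v • k = (5 : ℤ) ^ w • l) : k = l := by
  wlog hvw : v ≤ w generalizing v w k l
  · exact (this hl hk h.symm (le_of_not_ge hvw)).symm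
  obtain ⟨d, rfl⟩ := Nat.exists_eq_add_of_le hvw
  rw [pow_add, ← smul_smul] at h
  have h' : k = (5 : ℤ) ^ d • l := smul_right_injective _ (by positivity) h
  rcases d with _ | d
  · simpa using h'
  · refine absurd (mod5_eq_zero.2 ⟨(5 : ℤ) ^ d • l, ?_⟩) hk
    rw [h', smul_smul, pow_succ']

open Classical in
/-- The reduction modulo `5` of the quotient of `k` by the largest power of `5` dividing it. -/
def residue (k : Fin 3 → ℤ) : Fin 3 → ZMod 5 :=
  if hk : k = 0 then 0 else mod5 (exists_eq_pow_smul hk).choose_spec.choose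

lemma residue_pow_smul (v : ℕ) {k : Fin 3 → ℤ} (hk : mod5 k ≠ 0) :
    residue ((5 : ℤ) ^ v • k) = mod5 k := by
  have hk0 : (5 : ℤ) ^ v • k ≠ 0 := smul_ne_zero (by positivity) fun h ↦ hk (by
    rw [h]; ext; simp [mod5])
  unfold residue
  rw [dif_neg hk0]
  obtain ⟨h1, h2⟩ := (exists_eq_pow_smul hk0).choose_spec.choose_spec
  rw [← eq_of_pow_smul_eq hk h2 h1]

lemma residue_ne_zero {k : Fin 3 → ℤ} (hk : k ≠ 0) : residue k ≠ 0 := by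
  obtain ⟨v, k₀, rfl, h⟩ := exists_eq_pow_smul hk
  rwa [residue_pow_smul v h]

lemma residue_smul {a : ℤ} (ha : a ≠ 0) (k : Fin 3 → ℤ) :
    ∃ c : ZMod 5, c ≠ 0 ∧ residue (a • k) = c • residue k := by
  by_cases hk : k = 0
  · exact ⟨1, one_ne_zero, by simp [hk]⟩
  obtain ⟨v, k₀, rfl, h⟩ := exists_eq_pow_smul hk
  obtain ⟨s, a₀, ha₀, rfl⟩ : ∃ s a₀, ¬ (5 : ℤ) ∣ a₀ ∧ a = 5 ^ s * a₀ := by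
    have hf : FiniteMultiplicity (5 : ℤ) a := Int.finiteMultiplicity_iff.2 ⟨by decide, ha⟩
    obtain ⟨c, h1, h2⟩ := hf.exists_eq_pow_mul_and_not_dvd
    exact ⟨_, c, h2, h1⟩
  have hc : (a₀ : ZMod 5) ≠ 0 := fun h ↦ ha₀ ((ZMod.intCast_zmod_eq_zero_iff_dvd a₀ 5).1 h)
  refine ⟨a₀, hc, ?_⟩
  have h' : mod5 (a₀ • k₀) ≠ 0 := by
    rw [mod5_smul]
    exact smul_ne_zero hc h
  have : (5 ^ s * a₀) • (5 : ℤ) ^ v • k₀ = (5 : ℤ) ^ (s + v) • a₀ • k₀ := by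
    simp only [smul_smul, pow_add]; ring_nf
  rw [this, residue_pow_smul _ h', residue_pow_smul _ h, mod5_smul]

/-- `k` is orthogonal to `axisVec i` modulo `5`, after removal of the powers of `5`. -/
def IsPerp (i : Fin 6) (k : Fin 3 → ℤ) : Prop := mod5 (axisVec i) ⬝ᵥ residue k = 0

/-- `k` is parallel to `axisVec i` modulo `5`, after removal of the powers of `5`. -/
def IsPar (i : Fin 6) (k : Fin 3 → ℤ) : Prop := ∃ c : ZMod 5, residue k = c • mod5 (axisVec i)

open Classical in
lemma card_isPerp_le {k : Fin 3 → ℤ} (hk : k ≠ 0) :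
    (Finset.univ.filter fun i ↦ IsPerp i k).card ≤ 2 := by
  have key : ∀ a b c : ZMod 5, ![a, b, c] ≠ 0 →
      (Finset.univ.filter fun i ↦ mod5 (axisVec i) ⬝ᵥ ![a, b, c] = 0).card ≤ 2 := by
    decide +kernel
  have h := residue_ne_zero hk
  have h3 : residue k = ![residue k 0, residue k 1, residue k 2] := by
    ext j; fin_cases j <;> rfl
  rw [h3] at h
  refine le_trans (le_of_eq ?_) (key _ _ _ h)
  rw [← h3]
  congr!

open Classical in
lemma card_isPar_le {k : Fin 3 → ℤ} (hk : k ≠ 0) :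
    (Finset.univ.filter fun i ↦ IsPar i k).card ≤ 1 := by
  have key : ∀ i j, ∀ a b : ZMod 5, a • mod5 (axisVec i) = b • mod5 (axisVec j) → a = 0 ∨ i = j := by
    decide +kernel
  refine Finset.card_le_one.2 fun i hi j hj ↦ ?_
  obtain ⟨a, ha⟩ := (Finset.mem_filter.1 hi).2
  obtain ⟨b, hb⟩ := (Finset.mem_filter.1 hj).2
  refine (key i j a b (ha.symm.trans hb)).resolve_left fun h0 ↦ residue_ne_zero hk ?_
  rw [ha, h0, zero_smul]

/-- The half-turn about `axisVec i` maps all lines which are not orthogonal to the axis modulo `5`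
to lines which are parallel to the axis modulo `5`. -/
lemma isPar_of_smul_eq {i : Fin 6} {k l : Fin 3 → ℤ} {a b : ℤ} (ha : a ≠ 0) (hb : b ≠ 0)
    (hk : k ≠ 0) (h : a • l = b • turn i k) (hi : ¬ IsPerp i k) : IsPar i l := by
  obtain ⟨v, k₀, rfl, hk₀⟩ := exists_eq_pow_smul hk
  rw [IsPerp, residue_pow_smul v hk₀] at hi
  have haxis : ∀ i, mod5 (axisVec i) ≠ 0 := by decide
  have h1 : mod5 (turn i k₀) = (2 * (mod5 (axisVec i) ⬝ᵥ mod5 k₀)) • mod5 (axisVec i) := by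
    rw [turn_int]
    ext j
    have h5 : (5 : ZMod 5) = 0 := by decide
    simp [mod5, dotProduct, h5]
  have h2 : (2 : ZMod 5) ≠ 0 := by decide
  have h3 : mod5 (turn i k₀) ≠ 0 := h1 ▸ smul_ne_zero (mul_ne_zero h2 hi) (haxis i)
  have h4 : turn i ((5 : ℤ) ^ v • k₀) = (5 : ℤ) ^ v • turn i k₀ := map_zsmul _ _ _
  rw [h4] at h
  obtain ⟨c, hc, hc'⟩ := residue_smul ha l
  obtain ⟨d, -, hd'⟩ := residue_smul hb ((5 : ℤ) ^ v • turn i k₀)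
  rw [h, hd', residue_pow_smul v h3, h1] at hc'
  refine ⟨c⁻¹ * (d * (2 * (mod5 (axisVec i) ⬝ᵥ mod5 k₀))), ?_⟩
  rw [mul_smul, mul_smul, hc', smul_smul, inv_mul_cancel₀ hc, one_smul]

end Residue

section Torus

open UnitAddTorus

open scoped ComplexConjugate InnerProductSpace

local instance : MeasureSpace UnitAddCircle := ⟨AddCircle.haarAddCircle⟩

local instance : Measure.IsAddHaarMeasure (volume : Measure UnitAddCircle) :=
  inferInstanceAs (Measure.IsAddHaarMeasure AddCircle.haarAddCircle)

local instance : IsProbabilityMeasure (volume : Measure UnitAddCircle) :=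
  inferInstanceAs (IsProbabilityMeasure AddCircle.haarAddCircle)

local notation "𝕋" => UnitAddTorus (Fin 3)

lemma exists_smul_eq_torus {a : ℤ} (ha : a ≠ 0) (t : 𝕋) : ∃ s : 𝕋, a • s = t := by
  have : ∀ j, ∃ x : ℝ, (x : UnitAddCircle) = t j := fun j ↦ QuotientAddGroup.mk_surjective (t j)
  choose x hx using this
  refine ⟨fun j ↦ ((x j / a : ℝ) : UnitAddCircle), funext fun j ↦ ?_⟩
  have ha' : (a : ℝ) ≠ 0 := by exact_mod_cast ha
  rw [Pi.smul_apply, ← AddCircle.coe_zsmul, zsmul_eq_mul, mul_div_cancel₀ _ ha', hx]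

lemma measurePreserving_turn (i : Fin 6) :
    MeasurePreserving (turn i : 𝕋 → 𝕋) volume volume := by
  let g : 𝕋 →+ 𝕋 := turn i
  refine AddMonoidHom.measurePreserving (f := g) ?_ ?_ rfl
  · refine continuous_pi fun j ↦ ?_
    change Continuous fun t : 𝕋 ↦ ∑ l, turnMatrix i j l • t l
    fun_prop
  · intro t
    obtain ⟨s, hs⟩ := exists_smul_eq_torus (show (25 : ℤ) ≠ 0 by norm_num) t
    exact ⟨turn i s, by rw [turn_turn, hs]⟩

lemma measurePreserving_five_smul :
    MeasurePreserving (fun t : 𝕋 ↦ (5 : ℤ) • t) volume volume := by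
  refine AddMonoidHom.measurePreserving (f := zsmulAddGroupHom (α := 𝕋) 5) ?_ ?_ rfl
  · exact continuous_zsmul 5
  · exact exists_smul_eq_torus (by norm_num)

lemma mFourier_eq_toCircle (k : Fin 3 → ℤ) (t : 𝕋) :
    mFourier k t = (∑ j, k j • t j : UnitAddCircle).toCircle := by
  simp only [mFourier, ContinuousMap.coe_mk, fourier_apply, Fin.prod_univ_three,
    Fin.sum_univ_three, AddCircle.toCircle_add, Circle.coe_mul]

lemma mFourier_turn (i : Fin 6) (k : Fin 3 → ℤ) (t : 𝕋) :
    mFourier k (turn i t) = mFourier (turn i k) t := by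
  rw [mFourier_eq_toCircle, mFourier_eq_toCircle]
  congr 2
  simp only [turn_apply, Finset.smul_sum, Finset.sum_smul, smul_smul, smul_eq_mul]
  rw [Finset.sum_comm]
  simp only [mul_comm, turnMatrix_symm]

lemma mFourier_five_smul (k : Fin 3 → ℤ) (t : 𝕋) :
    mFourier k ((5 : ℤ) • t) = mFourier ((5 : ℤ) • k) t := by
  rw [mFourier_eq_toCircle, mFourier_eq_toCircle]
  congr 2
  simp only [Pi.smul_apply, smul_smul, smul_eq_mul, mul_comm]

local notation "L²" => Lp ℂ 2 (volume : Measure 𝕋)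

lemma hasSum_compMeasurePreserving {φ : 𝕋 → 𝕋} (hφ : MeasurePreserving φ volume volume)
    {ψ : (Fin 3 → ℤ) → Fin 3 → ℤ} (h : ∀ k t, mFourier k (φ t) = mFourier (ψ k) t) (f : L²) :
    HasSum (fun k ↦ mFourierCoeff f k • (mFourierLp 2 (ψ k) : L²))
      (Lp.compMeasurePreserving φ hφ f) := by
  have h1 := (hasSum_mFourier_series_L2 f).map (Lp.compMeasurePreserving φ hφ)
    (Lp.isometry_compMeasurePreserving hφ).continuous
  refine h1.congr_fun fun k ↦ ?_
  apply Lp.ext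
  have h2 : (mFourierLp 2 k : L²) ∘ φ =ᵐ[volume] mFourier k ∘ φ :=
    hφ.quasiMeasurePreserving.ae_eq_comp (coeFn_mFourierLp 2 k)
  have h3 : (mFourierCoeff f k • (mFourierLp 2 k : L²) : L²) ∘ φ =ᵐ[volume]
      (mFourierCoeff f k • ((mFourierLp 2 k : L²) : 𝕋 → ℂ)) ∘ φ :=
    hφ.quasiMeasurePreserving.ae_eq_comp (Lp.coeFn_smul _ _)
  filter_upwards [Lp.coeFn_compMeasurePreserving (mFourierCoeff f k • (mFourierLp 2 k : L²)) hφ,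
    h2, h3, coeFn_mFourierLp 2 (ψ k), Lp.coeFn_smul (mFourierCoeff f k) (mFourierLp 2 (ψ k) : L²)]
    with t h4 h5 h6 h7 h8
  simp only [Function.comp_apply, Pi.smul_apply] at *
  rw [h4, h6, h8, h5, h7, h]

/-- The pairing of the Fourier mode `turn i k` with the function `h ∘ (5 • ·)`. -/
def pairing (i : Fin 6) (h : L²) (k : Fin 3 → ℤ) : ℂ :=
  ⟪Lp.compMeasurePreserving _ measurePreserving_five_smul h, (mFourierLp 2 (turn i k) : L²)⟫_ℂ

lemma hasSum_pairing (i : Fin 6) (f h : L²) :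
    HasSum (fun k ↦ mFourierCoeff f k * pairing i h k)
      ⟪Lp.compMeasurePreserving _ measurePreserving_five_smul h,
        Lp.compMeasurePreserving _ (measurePreserving_turn i) f⟫_ℂ := by
  have := (hasSum_compMeasurePreserving (measurePreserving_turn i) (mFourier_turn i) f).mapL
    (innerSL ℂ (Lp.compMeasurePreserving _ measurePreserving_five_smul h))
  simpa [inner_smul_right, pairing] using this

lemma hasSum_conj_pairing (i : Fin 6) (h : L²) (k : Fin 3 → ℤ) :
    HasSum (fun l ↦ if turn i k = (5 : ℤ) • l then mFourierCoeff h l else 0)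
      (conj (pairing i h k)) := by
  have := (hasSum_compMeasurePreserving measurePreserving_five_smul mFourier_five_smul h).mapL
    (innerSL ℂ (mFourierLp 2 (turn i k) : L²))
  rw [pairing, inner_conj_symm]
  refine this.congr_fun fun l ↦ ?_
  simp only [innerSL_apply_apply, inner_smul_right,
    orthonormal_iff_ite.1 (orthonormal_mFourier (d := Fin 3)), mul_ite, mul_one, mul_zero]

lemma pairing_of_eq {i : Fin 6} (h : L²) {k l : Fin 3 → ℤ} (hkl : turn i k = (5 : ℤ) • l) :
    pairing i h k = conj (mFourierCoeff h l) := by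
  have h1 := hasSum_conj_pairing i h k
  have h2 := hasSum_single (f := fun l ↦ if turn i k = (5 : ℤ) • l then mFourierCoeff h l else 0) l
    (fun l' hl' ↦ if_neg fun h' ↦ hl' (by
      rw [hkl] at h'
      exact (smul_right_injective _ (show (5 : ℤ) ≠ 0 by norm_num) h').symm))
  rw [if_pos hkl] at h2
  rw [← h1.unique h2, Complex.conj_conj]

lemma pairing_of_ne {i : Fin 6} (h : L²) {k : Fin 3 → ℤ} (hk : ∀ l, turn i k ≠ (5 : ℤ) • l) :
    pairing i h k = 0 := by
  have h1 := hasSum_conj_pairing i h k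
  simp only [hk, if_false] at h1
  simpa using h1.unique hasSum_zero

open Classical in
lemma sum_perp_weight_le {k : Fin 3 → ℤ} (hk : k ≠ 0) :
    ∑ i, (if IsPerp i k then 1 / 2 else 1 / 4 : ℝ) ≤ 2 := by
  have h1 : ∀ i, (if IsPerp i k then 1 / 2 else 1 / 4 : ℝ) =
      1 / 4 + 1 / 4 * (if IsPerp i k then 1 else 0) := fun i ↦ by split_ifs <;> norm_num
  have h2 : ((Finset.univ.filter fun i ↦ IsPerp i k).card : ℝ) ≤ 2 := by
    exact_mod_cast card_isPerp_le hk
  simp only [h1, Finset.sum_add_distrib, ← Finset.mul_sum, Finset.sum_boole, Finset.sum_const,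
    Finset.card_univ, Fintype.card_fin, nsmul_eq_mul]
  norm_num
  linarith

open Classical in
lemma sum_par_weight_le {k : Fin 3 → ℤ} (hk : k ≠ 0) :
    ∑ i, (if IsPar i k then 1 else 1 / 2 : ℝ) ≤ 7 / 2 := by
  have h1 : ∀ i, (if IsPar i k then 1 else 1 / 2 : ℝ) =
      1 / 2 + 1 / 2 * (if IsPar i k then 1 else 0) := fun i ↦ by split_ifs <;> norm_num
  have h2 : ((Finset.univ.filter fun i ↦ IsPar i k).card : ℝ) ≤ 1 := by
    exact_mod_cast card_isPar_le hk
  simp only [h1, Finset.sum_add_distrib, ← Finset.mul_sum, Finset.sum_boole, Finset.sum_const,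
    Finset.card_univ, Fintype.card_fin, nsmul_eq_mul]
  norm_num
  linarith

/-- The squared norms of the nonconstant Fourier coefficients. -/
def fourierEnergy (f : L²) (k : Fin 3 → ℤ) : ℝ := if k = 0 then 0 else ‖mFourierCoeff f k‖ ^ 2

lemma fourierEnergy_nonneg (f : L²) (k : Fin 3 → ℤ) : 0 ≤ fourierEnergy f k := by
  unfold fourierEnergy; split_ifs <;> positivity

lemma hasSum_fourierEnergy (f : L²) :
    HasSum (fourierEnergy f) ((∫ t, ‖f t‖ ^ 2) - ‖mFourierCoeff f 0‖ ^ 2) :=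
  hasSum_ite_sub_hasSum (hasSum_sq_mFourierCoeff f) 0

open Classical in
lemma summable_pairing (i : Fin 6) (h : L²) :
    Summable (fun k ↦ if k = 0 then 0 else
      (if IsPerp i k then 1 / 2 else 1) * ‖pairing i h k‖ ^ 2) ∧
    ∑' k, (if k = 0 then 0 else (if IsPerp i k then 1 / 2 else 1) * ‖pairing i h k‖ ^ 2) ≤
      ∑' l, (if IsPar i l then 1 else 1 / 2) * fourierEnergy h l := by
  set F : (Fin 3 → ℤ) → ℝ := fun k ↦ if k = 0 then 0 else
      (if IsPerp i k then 1 / 2 else 1) * ‖pairing i h k‖ ^ 2 with hF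
  set S : Set (Fin 3 → ℤ) := {k | ∃ l, turn i k = (5 : ℤ) • l} with hS
  set G : (Fin 3 → ℤ) → ℝ := fun l ↦ (if IsPar i l then 1 else 1 / 2) * fourierEnergy h l with hG
  have hG0 : ∀ l, 0 ≤ G l := fun l ↦ by
    have := fourierEnergy_nonneg h l
    simp only [hG]
    positivity
  have hGs : Summable G := by
    refine Summable.of_nonneg_of_le hG0 (fun l ↦ ?_) (hasSum_fourierEnergy h).summable
    have := fourierEnergy_nonneg h l
    simp only [hG]
    split_ifs <;> linarith
  have hF0 : ∀ k, 0 ≤ F k := fun k ↦ by simp only [hF]; positivity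
  have hFS : S.indicator F = F := by
    refine Set.indicator_eq_self.2 fun k hk ↦ ?_
    by_contra hk'
    refine hk ?_
    simp only [hF]
    rw [pairing_of_ne h fun l hl ↦ hk' ⟨l, hl⟩]
    simp
  choose e he using fun k : S ↦ k.2
  have hinj : Function.Injective e := fun k k' hkk' ↦ by
    have h1 : turn i (k : Fin 3 → ℤ) = turn i k' := by rw [he, he, hkk']
    have h2 := congrArg (turn i) h1
    rw [turn_turn, turn_turn] at h2
    exact Subtype.ext (smul_right_injective _ (show (25 : ℤ) ≠ 0 by norm_num) h2)
  have hle : ∀ k : S, F k ≤ G (e k) := fun k ↦ by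
    by_cases hk : (k : Fin 3 → ℤ) = 0
    · simpa [hF, hk] using hG0 (e k)
    have hl : e k ≠ 0 := fun h0 ↦ hk (by
      have h1 := he k
      rw [h0, smul_zero] at h1
      have h2 := congrArg (turn i) h1
      rw [turn_turn, map_zero] at h2
      exact (smul_eq_zero.1 h2).resolve_left (by norm_num))
    simp only [hF, hG, fourierEnergy, hk, hl, if_false, pairing_of_eq h (he k),
      RCLike.norm_conj]
    refine mul_le_mul_of_nonneg_right ?_ (by positivity)
    by_cases hp : IsPerp i (k : Fin 3 → ℤ)
    · simp only [hp, if_true]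
      split_ifs <;> norm_num
    · have := isPar_of_smul_eq (a := 5) (b := 1) (by norm_num) (by norm_num) hk
        (by rw [one_smul, he k]) hp
      simp [hp, this]
  have hs : Summable (F ∘ (↑) : S → ℝ) :=
    Summable.of_nonneg_of_le (fun k ↦ hF0 k) hle (hGs.comp_injective hinj)
  have hsF : Summable F := by
    rw [← hFS]
    exact summable_subtype_iff_indicator.1 hs
  refine ⟨hsF, ?_⟩
  calc ∑' k, F k = ∑' k, S.indicator F k := by rw [hFS]
    _ = ∑' k : S, F k := (tsum_subtype S F).symm
    _ ≤ ∑' l, G l := Summable.tsum_le_tsum_of_inj e hinj (fun l _ ↦ hG0 l) hle hs hGs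

lemma sq_le_of_forall_le {p x y : ℝ} (hp : 0 ≤ p) (hx : 0 ≤ x) (hy : 0 ≤ y)
    (h : ∀ s, 0 < s → p ≤ s * x + s⁻¹ * y) : p ^ 2 ≤ 4 * x * y := by
  have := discrim_le_zero (a := x) (b := -p) (c := y) fun s ↦ by
    rcases lt_or_ge 0 s with hs | hs
    · have := mul_le_mul_of_nonneg_left (h s hs) hs.le
      have h2 : s * (s * x + s⁻¹ * y) = s * s * x + y := by field_simp
      linarith
    · nlinarith [mul_self_nonneg s, mul_nonneg hx (mul_self_nonneg s)]
  unfold discrim at this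
  linarith

open Classical in
/-- The spectral estimate: functions with disjoint supports along the six half-turns cannot both
have large mean compared to their energy. -/
lemma norm_mul_norm_sq_le (f h : L²)
    (hfh : ∀ i, ⟪Lp.compMeasurePreserving _ measurePreserving_five_smul h,
        Lp.compMeasurePreserving _ (measurePreserving_turn i) f⟫_ℂ = 0) :
    (‖mFourierCoeff f 0‖ * ‖mFourierCoeff h 0‖) ^ 2 ≤ 7 / 9 *
      (((∫ t, ‖f t‖ ^ 2) - ‖mFourierCoeff f 0‖ ^ 2) *
        ((∫ t, ‖h t‖ ^ 2) - ‖mFourierCoeff h 0‖ ^ 2)) := by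
  have hC := hasSum_fourierEnergy f
  have hD := hasSum_fourierEnergy h
  set C := (∫ t, ‖f t‖ ^ 2) - ‖mFourierCoeff f 0‖ ^ 2
  set D := (∫ t, ‖h t‖ ^ 2) - ‖mFourierCoeff h 0‖ ^ 2
  have hC0 : 0 ≤ C := hC.nonneg (fourierEnergy_nonneg f)
  have hD0 : 0 ≤ D := hD.nonneg (fourierEnergy_nonneg h)
  set p := ‖mFourierCoeff f 0‖ * ‖mFourierCoeff h 0‖ with hp
  have hp0 : 0 ≤ p := by positivity
  have hPs : ∀ i, Summable fun k ↦ (if IsPerp i k then 1 / 2 else 1 / 4) * fourierEnergy f k :=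
    fun i ↦ by
      refine Summable.of_nonneg_of_le (fun k ↦ ?_) (fun k ↦ ?_) hC.summable
      · have := fourierEnergy_nonneg f k
        positivity
      · have := fourierEnergy_nonneg f k
        split_ifs <;> linarith
  have hQs : ∀ i, Summable fun k ↦ (if IsPar i k then 1 else 1 / 2) * fourierEnergy h k :=
    fun i ↦ by
      refine Summable.of_nonneg_of_le (fun k ↦ ?_) (fun k ↦ ?_) hD.summable
      · have := fourierEnergy_nonneg h k
        positivity
      · have := fourierEnergy_nonneg h k
        split_ifs <;> linarith
  have hone : ∀ i, ∀ s, 0 < s → p ≤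
      s * ∑' k, (if IsPerp i k then 1 / 2 else 1 / 4) * fourierEnergy f k +
      s⁻¹ * ∑' l, (if IsPar i l then 1 else 1 / 2) * fourierEnergy h l := fun i s hs ↦ by
    obtain ⟨hR, hR'⟩ := summable_pairing i h
    have hsum := hasSum_pairing i f h
    rw [hfh] at hsum
    have h0 : pairing i h 0 = conj (mFourierCoeff h 0) := pairing_of_eq h (by simp)
    have hsum' := hasSum_ite_sub_hasSum hsum 0
    have hb := hsum'.norm_le_of_bounded
      (((hPs i).hasSum.mul_left s).add (hR.hasSum.mul_left s⁻¹)) fun k ↦ by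
        by_cases hk : k = 0
        · simp [hk, fourierEnergy]
        simp only [hk, if_false, fourierEnergy, norm_mul]
        set a := ‖mFourierCoeff f k‖
        set b := ‖pairing i h k‖
        split_ifs
        · have : s * (1 / 2 * a ^ 2) + s⁻¹ * (1 / 2 * b ^ 2) - a * b =
              1 / 2 * s⁻¹ * (s * a - b) ^ 2 := by field_simp; ring
          have h2 : 0 ≤ 1 / 2 * s⁻¹ * (s * a - b) ^ 2 := by positivity
          linarith
        · have : s * (1 / 4 * a ^ 2) + s⁻¹ * (1 * b ^ 2) - a * b =
              1 / 4 * s⁻¹ * (s * a - 2 * b) ^ 2 := by field_simp; ring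
          have h2 : 0 ≤ 1 / 4 * s⁻¹ * (s * a - 2 * b) ^ 2 := by positivity
          linarith
    rw [h0, zero_sub, norm_neg, norm_mul, RCLike.norm_conj] at hb
    have := mul_le_mul_of_nonneg_left hR' (inv_nonneg.2 hs.le)
    linarith
  have hP : ∑ i, ∑' k, (if IsPerp i k then 1 / 2 else 1 / 4) * fourierEnergy f k ≤ 2 * C := by
    rw [← Summable.tsum_finsetSum fun i _ ↦ hPs i, ← hC.tsum_eq, ← tsum_mul_left]
    refine Summable.tsum_le_tsum (fun k ↦ ?_) (summable_sum fun i _ ↦ hPs i)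
      (hC.summable.mul_left 2)
    rw [← Finset.sum_mul]
    by_cases hk : k = 0
    · simp [hk, fourierEnergy]
    · exact mul_le_mul_of_nonneg_right (sum_perp_weight_le hk) (fourierEnergy_nonneg f k)
  have hQ : ∑ i, ∑' k, (if IsPar i k then 1 else 1 / 2) * fourierEnergy h k ≤ 7 / 2 * D := by
    rw [← Summable.tsum_finsetSum fun i _ ↦ hQs i, ← hD.tsum_eq, ← tsum_mul_left]
    refine Summable.tsum_le_tsum (fun k ↦ ?_) (summable_sum fun i _ ↦ hQs i)
      (hD.summable.mul_left _)
    rw [← Finset.sum_mul]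
    by_cases hk : k = 0
    · simp [hk, fourierEnergy]
    · exact mul_le_mul_of_nonneg_right (sum_par_weight_le hk) (fourierEnergy_nonneg h k)
  have hall : ∀ s, 0 < s → 6 * p ≤ s * (2 * C) + s⁻¹ * (7 / 2 * D) := fun s hs ↦ by
    have h1 : 6 * p ≤
        s * ∑ i, ∑' k, (if IsPerp i k then 1 / 2 else 1 / 4) * fourierEnergy f k +
        s⁻¹ * ∑ i, ∑' l, (if IsPar i l then 1 else 1 / 2) * fourierEnergy h l := by
      rw [Finset.mul_sum, Finset.mul_sum, ← Finset.sum_add_distrib]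
      calc 6 * p = ∑ _i : Fin 6, p := by simp
        _ ≤ _ := Finset.sum_le_sum fun i _ ↦ hone i s hs
    have h2 := mul_le_mul_of_nonneg_left hP hs.le
    have h3 := mul_le_mul_of_nonneg_left hQ (inv_nonneg.2 hs.le)
    linarith
  have := sq_le_of_forall_le (by positivity) (by positivity) (by positivity) hall
  linarith

/-- If no point `5 • t` of `W` is obtained from a point of `Y` by one of the half-turns, then the
measures of `Y` and `W` satisfy a spectral inequality. -/
theorem measureReal_mul_le_torus {Y W : Set 𝕋} (hY : MeasurableSet Y) (hW : MeasurableSet W)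
    (h : ∀ i t, turn i t ∈ Y → (5 : ℤ) • t ∉ W) :
    volume.real Y * volume.real W ≤
      7 / 9 * ((1 - volume.real Y) * (1 - volume.real W)) := by
  have hcoeff : ∀ {E : Set 𝕋} (hE : MeasurableSet E),
      mFourierCoeff (indicatorConstLp 2 hE (measure_ne_top volume E) (1 : ℂ)) 0 =
        volume.real E := fun {E} hE ↦ by
    have h1 : ∀ᵐ t, mFourier (-(0 : Fin 3 → ℤ)) t •
        (indicatorConstLp 2 hE (measure_ne_top volume E) (1 : ℂ)) t = E.indicator (fun _ ↦ 1) t := by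
      filter_upwards [indicatorConstLp_coeFn (p := 2) (hs := hE)
        (hμs := measure_ne_top volume E) (c := (1 : ℂ))] with t ht
      rw [ht, neg_zero, mFourier_zero]
      simp
    rw [mFourierCoeff, integral_congr_ae h1, integral_indicator_const _ hE]
    simp
  have hnorm : ∀ {E : Set 𝕋} (hE : MeasurableSet E),
      ∫ t, ‖(indicatorConstLp 2 hE (measure_ne_top volume E) (1 : ℂ)) t‖ ^ 2 =
        volume.real E := fun {E} hE ↦ by
    have h1 : ∀ᵐ t, ‖(indicatorConstLp 2 hE (measure_ne_top volume E) (1 : ℂ)) t‖ ^ 2 =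
        E.indicator (fun _ ↦ (1 : ℝ)) t := by
      filter_upwards [indicatorConstLp_coeFn (p := 2) (hs := hE)
        (hμs := measure_ne_top volume E) (c := (1 : ℂ))] with t ht
      rw [ht]
      by_cases htE : t ∈ E <;> simp [htE]
    rw [integral_congr_ae h1, integral_indicator_const _ hE]
    simp
  have key := norm_mul_norm_sq_le (indicatorConstLp 2 hY (measure_ne_top volume Y) (1 : ℂ))
    (indicatorConstLp 2 hW (measure_ne_top volume W) (1 : ℂ)) fun i ↦ by
      rw [L2.inner_def]
      refine integral_eq_zero_of_ae ?_
      have e1 := indicatorConstLp_coeFn (p := 2) (hs := hY)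
        (hμs := measure_ne_top volume Y) (c := (1 : ℂ))
      have e2 := indicatorConstLp_coeFn (p := 2) (hs := hW)
        (hμs := measure_ne_top volume W) (c := (1 : ℂ))
      have e1' := (measurePreserving_turn i).quasiMeasurePreserving.ae_eq_comp e1
      have e2' := measurePreserving_five_smul.quasiMeasurePreserving.ae_eq_comp e2
      filter_upwards [e1', e2', Lp.coeFn_compMeasurePreserving
        (indicatorConstLp 2 hY (measure_ne_top volume Y) (1 : ℂ)) (measurePreserving_turn i),
        Lp.coeFn_compMeasurePreserving
        (indicatorConstLp 2 hW (measure_ne_top volume W) (1 : ℂ)) measurePreserving_five_smul]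
        with t h1 h2 h3 h4
      simp only [Function.comp_apply] at h1 h2 h3 h4
      rw [h3, h4, h1, h2]
      by_cases ht : turn i t ∈ Y
      · simp [h i t ht]
      · simp [ht]
  rw [hcoeff hY, hcoeff hW, hnorm hY, hnorm hW] at key
  simp only [Complex.norm_real, Real.norm_eq_abs] at key
  set y := volume.real Y
  set w := volume.real W
  have hy0 : 0 ≤ y := measureReal_nonneg
  have hw0 : 0 ≤ w := measureReal_nonneg
  have hy1 : y ≤ 1 := measureReal_le_one
  have hw1 : w ≤ 1 := measureReal_le_one
  rw [abs_of_nonneg hy0, abs_of_nonneg hw0] at key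
  have hr : 0 ≤ (1 - y) * (1 - w) := mul_nonneg (by linarith) (by linarith)
  rcases (mul_nonneg hy0 hw0).eq_or_lt with h0 | h0
  · rw [← h0]; positivity
  · refine le_of_mul_le_mul_left ?_ h0
    linarith

/-- The half-open unit cube. -/
def unitCube : Set (EucSp 3) := {x | ∀ j, x j ∈ Ioc (0 : ℝ) 1}

lemma measurableSet_unitCube : MeasurableSet unitCube := by
  have : unitCube = ⋂ j, (fun x : EucSp 3 ↦ x j) ⁻¹' Ioc (0 : ℝ) 1 := by
    ext; simp [unitCube]
  rw [this]
  exact .iInter fun j ↦ measurableSet_Ioc.preimage (by fun_prop)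

/-- The representative in the unit cube of a point of the torus. -/
def cubeRep (t : 𝕋) : EucSp 3 := WithLp.toLp 2 (measurableEquivPiIoc 0 t).1

lemma cubeRep_mem (t : 𝕋) : cubeRep t ∈ unitCube := fun j ↦ by
  have := (measurableEquivPiIoc (0 : Fin 3 → ℝ) t).2 j
  rwa [Pi.zero_apply, zero_add] at this

lemma coe_cubeRep (t : 𝕋) (j : Fin 3) : ((cubeRep t j : ℝ) : UnitAddCircle) = t j :=
  congrFun ((measurableEquivPiIoc (0 : Fin 3 → ℝ)).symm_apply_apply t) j

lemma measurable_cubeRep : Measurable cubeRep :=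
  (PiLp.volume_preserving_toLp (Fin 3)).measurable.comp
    (measurable_subtype_coe.comp (measurableEquivPiIoc 0).measurable)

lemma volume_preimage_cubeRep {Y : Set (EucSp 3)} (hY : MeasurableSet Y) (hYQ : Y ⊆ unitCube) :
    volume (cubeRep ⁻¹' Y) = volume Y := by
  have hY' : MeasurableSet (WithLp.toLp 2 ⁻¹' Y : Set (Fin 3 → ℝ)) :=
    (PiLp.volume_preserving_toLp (Fin 3)).measurable hY
  rw [← (PiLp.volume_preserving_toLp (Fin 3)).measure_preimage hY.nullMeasurableSet]
  have h1 : cubeRep ⁻¹' Y = measurableEquivPiIoc 0 ⁻¹' (Subtype.val ⁻¹' (WithLp.toLp 2 ⁻¹' Y)) :=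
    rfl
  rw [h1, (measurePreserving_equivPiIoc (0 : Fin 3 → ℝ)).measure_preimage
    (measurable_subtype_coe hY').nullMeasurableSet]
  have hQ : MeasurableSet
      {x : Fin 3 → ℝ | ∀ i, x i ∈ Ioc ((0 : Fin 3 → ℝ) i) ((0 : Fin 3 → ℝ) i + 1)} :=
    MeasurableSet.univ_pi' fun i ↦ measurableSet_Ioc
  refine (comap_subtype_coe_apply hQ volume _).trans ?_
  congr 1
  refine Subset.antisymm (image_preimage_subset _ _) fun x hx ↦ ⟨⟨x, fun j ↦ ?_⟩, hx, rfl⟩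
  have := hYQ hx j
  rwa [Pi.zero_apply, zero_add]

lemma volume_real_preimage_cubeRep {Y : Set (EucSp 3)} (hY : MeasurableSet Y)
    (hYQ : Y ⊆ unitCube) : volume.real (cubeRep ⁻¹' Y) = volume.real Y :=
  congrArg ENNReal.toReal (volume_preimage_cubeRep hY hYQ)

lemma volume_unitCube : volume unitCube = 1 := by
  rw [← volume_preimage_cubeRep measurableSet_unitCube subset_rfl,
    show cubeRep ⁻¹' unitCube = univ from eq_univ_of_forall cubeRep_mem, measure_univ]

/-- The half-turn about `axisVec i`. -/
def halfTurn (i : Fin 6) : EucSp 3 ≃ₗᵢ[ℝ] EucSp 3 :=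
  (Submodule.span ℝ {(WithLp.toLp 2 fun j ↦ (axisVec i j : ℝ) : EucSp 3)}).reflection

lemma five_mul_halfTurn (i : Fin 6) (x : EucSp 3) (j : Fin 3) :
    5 * halfTurn i x j = turn i (fun l ↦ x l) j := by
  have hn : ‖(WithLp.toLp 2 fun j ↦ (axisVec i j : ℝ) : EucSp 3)‖ ^ 2 = 5 := by
    rw [EuclideanSpace.real_norm_sq_eq]
    fin_cases i <;> simp [axisVec, Fin.sum_univ_three] <;> norm_num
  rw [halfTurn, Submodule.reflection_singleton_apply]
  simp only [RCLike.ofReal_real_eq_id, id, hn]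
  simp only [PiLp.sub_apply, PiLp.smul_apply, PiLp.inner_apply, turn_apply, turnMatrix,
    RCLike.inner_apply, conj_trivial, smul_eq_mul, zsmul_eq_mul]
  fin_cases j <;> simp [Fin.sum_univ_three] <;> ring

/-- The translation by an integer vector. -/
def intShift (a : Fin 3 → ℤ) : EucSp 3 ≃ᵢ EucSp 3 :=
  IsometryEquiv.addRight (WithLp.toLp 2 fun j ↦ (a j : ℝ))

lemma intShift_apply (a : Fin 3 → ℤ) (x : EucSp 3) (j : Fin 3) : intShift a x j = x j + a j := rfl

/-- The isometries obtained by composing a half-turn with bounded integer translations. -/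
def turnShifts : Set (EucSp 3 ≃ᵢ EucSp 3) :=
  (fun p : Fin 6 × (Fin 3 → ℤ) × (Fin 3 → ℤ) ↦
    intShift p.2.2 * (halfTurn p.1).toIsometryEquiv * intShift p.2.1) ''
    (univ ×ˢ Icc (-16) 16 ×ˢ Icc (-16) 16)

lemma finite_turnShifts : turnShifts.Finite := (toFinite _).image _

lemma exists_mem_turnShifts (i : Fin 6) (t : 𝕋) :
    ∃ s ∈ turnShifts, s (cubeRep (turn i t)) = cubeRep ((5 : ℤ) • t) := by
  have hcoe : ∀ {x y : ℝ}, (x : UnitAddCircle) = y → ∃ a : ℤ, x + a = y := fun {x y} h ↦ by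
    obtain ⟨a, ha⟩ := AddSubgroup.mem_zmultiples_iff.1 ((QuotientAddGroup.eq).1 h)
    refine ⟨a, ?_⟩
    rw [zsmul_eq_mul, mul_one] at ha
    rw [ha]; ring
  have h1 : ∀ j, ∃ a : ℤ, cubeRep (turn i t) j + a = turn i (fun l ↦ cubeRep t l) j := fun j ↦ by
    refine hcoe ?_
    rw [coe_cubeRep, turn_apply, turn_apply]
    simp only [Fin.sum_univ_three, AddCircle.coe_add, AddCircle.coe_zsmul, coe_cubeRep]
  have h2 : ∀ j, ∃ b : ℤ, 5 * cubeRep t j + b = cubeRep ((5 : ℤ) • t) j := fun j ↦ by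
    refine hcoe ?_
    rw [coe_cubeRep, show 5 * cubeRep t j = (5 : ℤ) • cubeRep t j by simp, AddCircle.coe_zsmul,
      coe_cubeRep]
    rfl
  choose a ha using h1
  choose b hb using h2
  have hQ1 := cubeRep_mem (turn i t)
  have hQ2 := cubeRep_mem ((5 : ℤ) • t)
  have hQ3 := cubeRep_mem t
  have hbound : ∀ j, |turn i (fun l ↦ cubeRep t l) j| ≤ 15 := fun j ↦ by
    have hm : ∀ i j l, |turnMatrix i j l| ≤ 5 := by decide
    rw [turn_apply]
    refine (Finset.abs_sum_le_sum_abs _ _).trans ?_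
    calc ∑ l, |turnMatrix i j l • cubeRep t l| ≤ ∑ _l : Fin 3, (5 : ℝ) := by
          refine Finset.sum_le_sum fun l _ ↦ ?_
          rw [zsmul_eq_mul, abs_mul]
          have h1 : |(turnMatrix i j l : ℝ)| ≤ 5 := by exact_mod_cast hm i j l
          have h2 : |cubeRep t l| ≤ 1 := abs_le.2 ⟨by linarith [(hQ3 l).1], (hQ3 l).2⟩
          nlinarith [abs_nonneg (turnMatrix i j l : ℝ), abs_nonneg (cubeRep t l)]
      _ = 15 := by simp; norm_num
  refine ⟨_, ⟨⟨i, a, b⟩, ⟨mem_univ _, ⟨fun j ↦ ?_, fun j ↦ ?_⟩, ⟨fun j ↦ ?_, fun j ↦ ?_⟩⟩, rfl⟩, ?_⟩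
  · have : (-16 : ℝ) ≤ a j := by linarith [(abs_le.1 (hbound j)).1, ha j, (hQ1 j).2]
    exact_mod_cast this
  · have : (a j : ℝ) ≤ 16 := by linarith [(abs_le.1 (hbound j)).2, ha j, (hQ1 j).1]
    exact_mod_cast this
  · have : (-16 : ℝ) ≤ b j := by linarith [hb j, (hQ2 j).1, (hQ3 j).2]
    exact_mod_cast this
  · have : (b j : ℝ) ≤ 16 := by linarith [hb j, (hQ2 j).2, (hQ3 j).1]
    exact_mod_cast this
  · ext j
    simp only [IsometryEquiv.mul_apply, intShift_apply, LinearIsometryEquiv.coe_toIsometryEquiv]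
    rw [← hb]
    congr 1
    have h3 := five_mul_halfTurn i (intShift a (cubeRep (turn i t))) j
    have h4 : (fun l ↦ intShift a (cubeRep (turn i t)) l) = turn i (fun l ↦ cubeRep t l) :=
      funext fun l ↦ by rw [intShift_apply, ha]
    rw [h4, turn_turn] at h3
    simp only [Pi.smul_apply, zsmul_eq_mul, Int.cast_ofNat] at h3
    linarith

/-- The union of the images of `Y` under a set of isometries. -/
def smear (S : Set (EucSp 3 ≃ᵢ EucSp 3)) (Y : Set (EucSp 3)) : Set (EucSp 3) := ⋃ s ∈ S, s '' Y

lemma mem_smear {S : Set (EucSp 3 ≃ᵢ EucSp 3)} {Y : Set (EucSp 3)} {z : EucSp 3} :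
    z ∈ smear S Y ↔ ∃ s ∈ S, ∃ y ∈ Y, s y = z := by
  simp [smear]

lemma measurableSet_image_isometryEquiv (s : EucSp 3 ≃ᵢ EucSp 3) {Y : Set (EucSp 3)}
    (hY : MeasurableSet Y) : MeasurableSet (s '' Y) :=
  s.toHomeomorph.toMeasurableEquiv.measurableSet_image.2 hY

lemma measurableSet_smear {S : Set (EucSp 3 ≃ᵢ EucSp 3)} (hS : S.Finite) {Y : Set (EucSp 3)}
    (hY : MeasurableSet Y) : MeasurableSet (smear S Y) :=
  .biUnion hS.countable fun s _ ↦ measurableSet_image_isometryEquiv s hY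

lemma measureReal_smear_turnShifts {Y : Set (EucSp 3)} (hY : MeasurableSet Y)
    (hYQ : Y ⊆ unitCube) :
    volume.real Y * (1 - volume.real (smear turnShifts Y ∩ unitCube)) ≤
      7 / 9 * ((1 - volume.real Y) * volume.real (smear turnShifts Y ∩ unitCube)) := by
  have hZ := (measurableSet_smear finite_turnShifts hY).inter measurableSet_unitCube
  set Z := smear turnShifts Y ∩ unitCube with hZdef
  have h1 : volume.real (unitCube \ Z) = 1 - volume.real Z := by
    rw [measureReal_sdiff inter_subset_right hZ (by simp [volume_unitCube]), Measure.real,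
      volume_unitCube, ENNReal.toReal_one]
  have h2 : MeasurableSet (unitCube \ Z) := measurableSet_unitCube.diff hZ
  have key := measureReal_mul_le_torus (measurable_cubeRep hY) (measurable_cubeRep h2)
    fun i t hY' hW ↦ hW.2 ⟨by
      obtain ⟨s, hs, hst⟩ := exists_mem_turnShifts i t
      exact mem_smear.2 ⟨s, hs, _, hY', hst⟩, cubeRep_mem _⟩
  rw [volume_real_preimage_cubeRep hY hYQ, volume_real_preimage_cubeRep h2 sdiff_subset, h1,
    sub_sub_cancel] at key
  exact key

end Torus

section Smear

lemma measureReal_unitCube : volume.real unitCube = 1 := by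
  rw [Measure.real, volume_unitCube, ENNReal.toReal_one]

lemma measureReal_inter_unitCube_le (Y : Set (EucSp 3)) : volume.real (Y ∩ unitCube) ≤ 1 :=
  (measureReal_mono inter_subset_right (by simp [volume_unitCube])).trans_eq measureReal_unitCube

lemma smear_smear_subset (S T : Set (EucSp 3 ≃ᵢ EucSp 3)) (Y : Set (EucSp 3)) :
    smear S (smear T Y) ⊆ smear (image2 (· * ·) S T) Y := fun z hz ↦ by
  obtain ⟨s, hs, w, hw, rfl⟩ := mem_smear.1 hz
  obtain ⟨t, ht, y, hy, rfl⟩ := mem_smear.1 hw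
  exact mem_smear.2 ⟨_, mem_image2_of_mem hs ht, y, hy, rfl⟩

lemma smear_mono_right (S : Set (EucSp 3 ≃ᵢ EucSp 3)) {Y Z : Set (EucSp 3)} (h : Y ⊆ Z) :
    smear S Y ⊆ smear S Z :=
  biUnion_mono subset_rfl fun _ _ ↦ image_mono h

lemma exists_smear_unitCube_pow (k : ℕ) :
    ∃ S : Set (EucSp 3 ≃ᵢ EucSp 3), S.Finite ∧ ∀ Y ⊆ unitCube, MeasurableSet Y →
      volume.real Y * (1 - volume.real (smear S Y ∩ unitCube)) ≤
        (7 / 9) ^ k * ((1 - volume.real Y) * volume.real (smear S Y ∩ unitCube)) := by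
  induction k with
  | zero =>
    refine ⟨{1}, finite_singleton 1, fun Y hYQ _ ↦ le_of_eq ?_⟩
    have : smear {1} Y = Y := by simp [smear]
    rw [this, inter_eq_left.2 hYQ]
    ring
  | succ k ih =>
    obtain ⟨S, hS, h⟩ := ih
    refine ⟨_, finite_turnShifts.image2 (· * ·) hS, fun Y hYQ hY ↦ ?_⟩
    have h1 := h Y hYQ hY
    have h2 := measureReal_smear_turnShifts ((measurableSet_smear hS hY).inter
      measurableSet_unitCube) inter_subset_right
    have h3 : volume.real (smear turnShifts (smear S Y ∩ unitCube) ∩ unitCube) ≤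
        volume.real (smear (image2 (· * ·) turnShifts S) Y ∩ unitCube) :=
      measureReal_mono (inter_subset_inter_left _
        ((smear_mono_right _ inter_subset_left).trans (smear_smear_subset _ _ _)))
        (ne_top_of_le_ne_top (by simp [volume_unitCube]) (measure_mono inter_subset_right))
    have hy1 : volume.real Y ≤ 1 := by
      simpa [inter_eq_left.2 hYQ] using measureReal_inter_unitCube_le Y
    have hz1 := measureReal_inter_unitCube_le (smear S Y)
    have hw1 := measureReal_inter_unitCube_le (smear turnShifts (smear S Y ∩ unitCube))
    have hw0 : 0 ≤ volume.real (smear turnShifts (smear S Y ∩ unitCube) ∩ unitCube) :=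
      measureReal_nonneg
    have hz0 : 0 ≤ volume.real (smear S Y ∩ unitCube) := measureReal_nonneg
    have hy0 : 0 ≤ volume.real Y := measureReal_nonneg
    generalize volume.real (smear (image2 (· * ·) turnShifts S) Y ∩ unitCube) = v at *
    generalize volume.real (smear turnShifts (smear S Y ∩ unitCube) ∩ unitCube) = w at *
    generalize volume.real (smear S Y ∩ unitCube) = z at *
    generalize volume.real Y = y at *
    have hc : (0 : ℝ) < (7 / 9) ^ k := by positivity
    rw [pow_succ]
    generalize ((7 : ℝ) / 9) ^ k = c at *
    have key : y * (1 - w) ≤ c * (7 / 9) * ((1 - y) * w) := by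
      have hr : 0 ≤ c * (7 / 9) * ((1 - y) * w) := by
        have : 0 ≤ 1 - y := by linarith
        positivity
      rcases hz0.eq_or_lt with hz | hz
      · have : y = 0 := by subst hz; linarith
        rw [this, zero_mul]
        rwa [this] at hr
      · rcases hz1.eq_or_lt with hz' | hz'
        · have : w = 1 := by subst hz'; linarith
          rw [this] at hr ⊢
          simpa using hr
        · have h4 := mul_le_mul h1 h2 (mul_nonneg hz0 (by linarith))
            (mul_nonneg hc.le (mul_nonneg (by linarith) hz0))
          refine le_of_mul_le_mul_left (a := z * (1 - z)) ?_ (mul_pos hz (by linarith))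
          linarith
    calc y * (1 - v) ≤ y * (1 - w) := by gcongr
      _ ≤ _ := key
      _ ≤ c * (7 / 9) * ((1 - y) * v) := by
        have : 0 ≤ 1 - y := by linarith
        gcongr

lemma exists_smear_unitCube {η : ℝ} (hη : 0 < η) :
    ∃ S : Set (EucSp 3 ≃ᵢ EucSp 3), S.Finite ∧ ∀ Y ⊆ unitCube, MeasurableSet Y →
      volume.real Y * (1 - volume.real (smear S Y ∩ unitCube)) ≤
        η * volume.real (smear S Y ∩ unitCube) := by
  obtain ⟨k, hk⟩ := exists_pow_lt_of_lt_one hη (by norm_num : (7 / 9 : ℝ) < 1)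
  obtain ⟨S, hS, h⟩ := exists_smear_unitCube_pow k
  refine ⟨S, hS, fun Y hYQ hY ↦ (h Y hYQ hY).trans ?_⟩
  have h1 : (1 - volume.real Y) * volume.real (smear S Y ∩ unitCube) ≤
      volume.real (smear S Y ∩ unitCube) :=
    mul_le_of_le_one_left measureReal_nonneg (sub_le_self _ measureReal_nonneg)
  exact (mul_le_mul_of_nonneg_left h1 (by positivity)).trans
    (mul_le_mul_of_nonneg_right hk.le measureReal_nonneg)

lemma measurePreserving_isometryEquiv (s : EucSp 3 ≃ᵢ EucSp 3) :
    MeasurePreserving s volume volume := by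
  have := s.measurePreserving_euclideanHausdorffMeasure 3
  rwa [EuclideanSpace.euclideanHausdorffMeasure_eq_volume 3] at this

lemma measure_image_isometryEquiv (s : EucSp 3 ≃ᵢ EucSp 3) (Y : Set (EucSp 3)) :
    volume (s '' Y) = volume Y :=
  MeasurePreserving.measure_image_equiv (e := s.toHomeomorph.toMeasurableEquiv)
    (measurePreserving_isometryEquiv s) Y

lemma measureReal_smear_le (S : Finset (EucSp 3 ≃ᵢ EucSp 3)) (Y : Set (EucSp 3)) :
    volume.real (smear S Y) ≤ S.card * volume.real Y := by
  refine (measureReal_biUnion_finset_le S _).trans_eq ?_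
  simp [Measure.real, measure_image_isometryEquiv]

lemma isOpen_cube (a : ℝ) : IsOpen {x : EucSp 3 | ∀ j, x j ∈ Ioo (0 : ℝ) a} := by
  have : {x : EucSp 3 | ∀ j, x j ∈ Ioo (0 : ℝ) a} =
      ⋂ j, (fun x : EucSp 3 ↦ x j) ⁻¹' Ioo (0 : ℝ) a := by ext; simp
  rw [this]
  exact isOpen_iInter_of_finite fun j ↦ isOpen_Ioo.preimage (by fun_prop)

lemma interior_unitCube_nonempty : (interior unitCube).Nonempty := by
  refine ⟨WithLp.toLp 2 fun _ ↦ 1 / 2, interior_maximal (fun x hx j ↦ ?_) (isOpen_cube 1) fun j ↦ ?_⟩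
  · exact Ioo_subset_Ioc_self (hx j)
  · norm_num

lemma isBounded_unitCube : Bornology.IsBounded unitCube := by
  refine (Metric.isBounded_iff_subset_closedBall 0).2 ⟨2, fun x hx ↦ ?_⟩
  rw [mem_closedBall_zero_iff, EuclideanSpace.norm_eq, Real.sqrt_le_left (by norm_num)]
  calc ∑ j, ‖x j‖ ^ 2 ≤ ∑ _j : Fin 3, (1 : ℝ) := by
        refine Finset.sum_le_sum fun j _ ↦ ?_
        rw [Real.norm_eq_abs, sq_abs]
        nlinarith [(hx j).1, (hx j).2]
    _ ≤ 2 ^ 2 := by norm_num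

lemma exists_subset_smear {A V : Set (EucSp 3)} (hA : Bornology.IsBounded A)
    (hV : (interior V).Nonempty) :
    ∃ G : Finset (EucSp 3 ≃ᵢ EucSp 3), A ⊆ smear G V := by
  classical
  obtain ⟨t, ht⟩ := compact_covered_by_add_left_translates hA.isCompact_closure hV
  refine ⟨t.image fun g ↦ IsometryEquiv.addLeft (-g), fun x hx ↦ ?_⟩
  obtain ⟨g, hg, hx'⟩ := mem_iUnion₂.1 (ht (subset_closure hx))
  refine mem_smear.2 ⟨IsometryEquiv.addLeft (-g), ?_, g + x, hx', by simp⟩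
  exact Finset.mem_coe.2 (Finset.mem_image_of_mem _ hg)

lemma exists_smear_expanding {A B : Set (EucSp 3)} (hA : Bornology.IsBounded A)
    (hB : Bornology.IsBounded B) (hBm : MeasurableSet B) (hBi : (interior B).Nonempty) :
    ∃ T : Set (EucSp 3 ≃ᵢ EucSp 3), T.Finite ∧ ∀ E ⊆ A, MeasurableSet E →
      min (2 * volume.real E) (2 / 3 * volume.real B) ≤ volume.real (smear T E ∩ B) := by
  obtain ⟨G, hG⟩ := exists_subset_smear hA interior_unitCube_nonempty
  obtain ⟨H, hH⟩ := exists_subset_smear hB interior_unitCube_nonempty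
  obtain ⟨P, hP⟩ := exists_subset_smear isBounded_unitCube hBi
  have hBtop : volume B ≠ ⊤ := hB.measure_lt_top.ne
  have hb : 0 < volume.real B :=
    ENNReal.toReal_pos (Measure.measure_pos_of_nonempty_interior _ hBi).ne' hBtop
  set b := volume.real B with hbdef
  set K : ℝ := G.card + 1 with hK
  set L : ℝ := H.card + 1 with hL
  set M : ℝ := P.card + 1 with hM
  have hK0 : 0 < K := by positivity
  have hL0 : 0 < L := by positivity
  have hM0 : 0 < M := by positivity
  obtain ⟨S, hS, hSexp⟩ := exists_smear_unitCube (η := b / (6 * K * L * M)) (by positivity)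
  set T : Set (EucSp 3 ≃ᵢ EucSp 3) :=
    (fun p : (EucSp 3 ≃ᵢ EucSp 3) × (EucSp 3 ≃ᵢ EucSp 3) × (EucSp 3 ≃ᵢ EucSp 3) ↦
      p.1 * p.2.1 * p.2.2⁻¹) ''
      ((↑H ∪ (fun p ↦ p⁻¹) '' (P : Set (EucSp 3 ≃ᵢ EucSp 3))) ×ˢ
        S ×ˢ (G : Set (EucSp 3 ≃ᵢ EucSp 3)))
  have hTfin : T.Finite :=
    (((H.finite_toSet.union (P.finite_toSet.image _)).prod (hS.prod G.finite_toSet)).image _)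
  have hmem : ∀ {E g h s y}, h ∈ ↑H ∪ (fun p ↦ p⁻¹) '' (P : Set (EucSp 3 ≃ᵢ EucSp 3)) → s ∈ S →
      g ∈ G → g y ∈ E → h (s y) ∈ smear T E := fun {E g h s y} hh hs hg hy ↦
    mem_smear.2 ⟨h * s * g⁻¹, ⟨(h, s, g), ⟨hh, hs, hg⟩, rfl⟩, g y, hy, by simp⟩
  refine ⟨T, hTfin, fun E hEA hE ↦ ?_⟩
  have hTE := measurableSet_smear hTfin hE
  have hYm : ∀ g : EucSp 3 ≃ᵢ EucSp 3, MeasurableSet (g ⁻¹' E ∩ unitCube) := fun g ↦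
    ((measurePreserving_isometryEquiv g).measurable hE).inter measurableSet_unitCube
  have htopQ : ∀ Y : Set (EucSp 3), volume (Y ∩ unitCube) ≠ ⊤ := fun Y ↦
    ne_top_of_le_ne_top (by simp [volume_unitCube]) (measure_mono inter_subset_right)
  by_cases hcase : ∃ g ∈ G,
      1 - volume.real (smear S (g ⁻¹' E ∩ unitCube) ∩ unitCube) ≤ b / (3 * L)
  · obtain ⟨g, hg, hz⟩ := hcase
    refine (min_le_right _ _).trans ?_
    set Z := smear S (g ⁻¹' E ∩ unitCube) ∩ unitCube with hZ
    have hZm : MeasurableSet Z := (measurableSet_smear hS (hYm g)).inter measurableSet_unitCube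
    have h1 : B \ (smear T E ∩ B) ⊆ smear H (unitCube \ Z) := fun x hx ↦ by
      obtain ⟨h, hh, q, hq, rfl⟩ := mem_smear.1 (hH hx.1)
      refine mem_smear.2 ⟨h, hh, q, ⟨hq, fun hqZ ↦ hx.2 ⟨?_, hx.1⟩⟩, rfl⟩
      obtain ⟨s, hs, y, hy, rfl⟩ := mem_smear.1 hqZ.1
      exact hmem (.inl hh) hs hg hy.1
    have h2 : volume.real (B \ (smear T E ∩ B)) ≤ H.card * (1 - volume.real Z) := by
      have h3 : volume.real (unitCube \ Z) = 1 - volume.real Z := by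
        rw [measureReal_sdiff inter_subset_right hZm (by simp [volume_unitCube]),
          measureReal_unitCube]
      rw [← h3]
      refine (measureReal_mono h1 ?_).trans (measureReal_smear_le _ _)
      exact ((measure_biUnion_lt_top H.finite_toSet fun s _ ↦ by
        rw [measure_image_isometryEquiv]
        exact (measure_mono sdiff_subset).trans_lt (by simp [volume_unitCube])).ne)
    rw [measureReal_sdiff inter_subset_right (hTE.inter hBm) hBtop] at h2
    have h4 : H.card * (1 - volume.real Z) ≤ L * (b / (3 * L)) := by
      have := measureReal_inter_unitCube_le (smear S (g ⁻¹' E ∩ unitCube))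
      exact mul_le_mul (by simp [hL]) hz (by linarith) hL0.le
    have h5 : L * (b / (3 * L)) = b / 3 := by field_simp
    linarith
  · push Not at hcase
    refine (min_le_left _ _).trans ?_
    set v := volume.real (smear T E ∩ B) with hv
    have hv0 : 0 ≤ v := measureReal_nonneg
    have h1 : ∀ g ∈ G, volume.real (g ⁻¹' E ∩ unitCube) ≤ v / (2 * K) := fun g hg ↦ by
      have h2 := hSexp _ inter_subset_right (hYm g)
      have h3 := hcase g hg
      have h4 : volume.real (smear S (g ⁻¹' E ∩ unitCube) ∩ unitCube) ≤ M * v := by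
        have h5 : smear S (g ⁻¹' E ∩ unitCube) ∩ unitCube ⊆ smear P (smear T E ∩ B) :=
            fun q hq ↦ by
          obtain ⟨p, hp, x, hx, rfl⟩ := mem_smear.1 (hP hq.2)
          refine mem_smear.2 ⟨p, hp, x, ⟨?_, hx⟩, rfl⟩
          obtain ⟨s, hs, y, hy, hsy⟩ := mem_smear.1 hq.1
          have : p⁻¹ (s y) ∈ smear T E := hmem (.inr ⟨p, hp, rfl⟩) hs hg hy.1
          rwa [hsy, IsometryEquiv.inv_apply_self] at this
        refine (measureReal_mono h5 ?_).trans ((measureReal_smear_le _ _).trans ?_)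
        · exact ((measure_biUnion_lt_top P.finite_toSet fun s _ ↦ by
            rw [measure_image_isometryEquiv]
            exact (measure_mono inter_subset_right).trans_lt hBtop.lt_top).ne)
        · exact mul_le_mul_of_nonneg_right (by simp [hM]) hv0
      have h6 : volume.real (g ⁻¹' E ∩ unitCube) * (b / (3 * L)) ≤
          b / (6 * K * L * M) * (M * v) :=
        (mul_le_mul_of_nonneg_left h3.le measureReal_nonneg).trans
          (h2.trans (mul_le_mul_of_nonneg_left h4 (by positivity)))
      have h7 : b / (6 * K * L * M) * (M * v) = v / (2 * K) * (b / (3 * L)) := by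
        field_simp; ring
      rw [h7] at h6
      exact le_of_mul_le_mul_right h6 (by positivity)
    have h2 : volume.real E ≤ ∑ g ∈ G, volume.real (g ⁻¹' E ∩ unitCube) := by
      have h3 : E ⊆ ⋃ g ∈ G, g '' (g ⁻¹' E ∩ unitCube) := fun x hx ↦ by
        obtain ⟨g, hg, q, hq, rfl⟩ := mem_smear.1 (hG (hEA hx))
        exact mem_iUnion₂.2 ⟨g, hg, q, ⟨hx, hq⟩, rfl⟩
      refine (measureReal_mono h3 ?_).trans ((measureReal_biUnion_finset_le _ _).trans_eq ?_)
      · exact ((measure_biUnion_lt_top G.finite_toSet fun s _ ↦ by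
          rw [measure_image_isometryEquiv]
          exact (htopQ _).lt_top).ne)
      · simp [Measure.real, measure_image_isometryEquiv]
    have h3 := h2.trans (Finset.sum_le_card_nsmul _ _ _ h1)
    rw [nsmul_eq_mul] at h3
    have h4 : G.card * (v / (2 * K)) ≤ K * (v / (2 * K)) :=
      mul_le_mul_of_nonneg_right (by simp [hK]) (by positivity)
    have h5 : K * (v / (2 * K)) = v / 2 := by field_simp
    linarith

/-- The measurable equivalence underlying an isometry of space. -/
abbrev isometryMeasurableEquiv (s : EucSp 3 ≃ᵢ EucSp 3) : EucSp 3 ≃ᵐ EucSp 3 :=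
  s.toHomeomorph.toMeasurableEquiv

lemma exists_finite_isExpanding {A B : Set (EucSp 3)} (hA : Bornology.IsBounded A)
    (hB : Bornology.IsBounded B) (hAm : MeasurableSet A) (hBm : MeasurableSet B)
    (hAi : (interior A).Nonempty) (hBi : (interior B).Nonempty) (hAB : volume A = volume B) :
    ∃ T : Set (EucSp 3 ≃ᵢ EucSp 3), T.Finite ∧
      IsExpanding (fun s : T ↦ isometryMeasurableEquiv s) A B volume := by
  obtain ⟨T₁, hT₁, h₁⟩ := exists_smear_expanding hA hB hBm hBi
  obtain ⟨T₂, hT₂, h₂⟩ := exists_smear_expanding hB hA hAm hAi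
  have hreal : volume.real B = volume.real A := congrArg ENNReal.toReal hAB.symm
  refine ⟨T₁ ∪ (fun s ↦ s⁻¹) '' T₂, hT₁.union (hT₂.image _),
    ⟨fun s ↦ measurePreserving_isometryEquiv s, hAm, hBm, hAB.symm, hA.measure_lt_top.ne,
      fun E hE hEm ↦ ?_, fun F hF hFm ↦ ?_⟩⟩
  · rw [← hreal]
    refine (h₁ E hE hEm).trans (measureReal_mono (inter_subset_inter_left _ fun x hx ↦ ?_)
      (ne_top_of_le_ne_top hB.measure_lt_top.ne (measure_mono inter_subset_right)))
    obtain ⟨s, hs, y, hy, rfl⟩ := mem_smear.1 hx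
    exact mem_spread.2 ⟨⟨s, .inl hs⟩, y, hy, rfl⟩
  · refine (h₂ F hF hFm).trans (measureReal_mono (fun x hx ↦ ⟨hx.2, ?_⟩)
      (ne_top_of_le_ne_top hA.measure_lt_top.ne (measure_mono inter_subset_left)))
    obtain ⟨s, hs, y, hy, rfl⟩ := mem_smear.1 hx.1
    refine mem_iUnion.2 ⟨⟨s⁻¹, .inr ⟨s, hs, rfl⟩⟩, ?_⟩
    change s⁻¹ (s y) ∈ F
    rwa [IsometryEquiv.inv_apply_self]

end Smear

section Expansion

lemma exists_int_smul (v : Fin 3 → ℚ) :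
    ∃ (N : ℤ) (k : Fin 3 → ℤ), N ≠ 0 ∧ ∀ j, (k j : ℚ) = N * v j := by
  obtain ⟨b, hb⟩ := IsLocalization.exist_integer_multiples_of_finite (nonZeroDivisors ℤ) v
  choose k hk using hb
  exact ⟨b, k, nonZeroDivisors.ne_zero b.2, fun j ↦ by simpa [Submonoid.smul_def] using hk j⟩

lemma exists_ne_zero_coord {x : EucSp 3} (hx : x ≠ 0) : ∃ j, x j ≠ 0 := by
  by_contra! h
  exact hx (PiLp.ext h)

open Classical in
/-- The six half-turns expand finite sets of nonzero vectors by the factor `4`. -/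
lemma four_mul_card_le_card_biUnion_halfTurn (F : Finset (EucSp 3)) (hF : 0 ∉ F) :
    4 * F.card ≤ (Finset.univ.biUnion fun i ↦ F.image (halfTurn i)).card := by
  set U := Finset.univ.biUnion fun i ↦ F.image (halfTurn i) with hU
  have hU0 : ∀ y ∈ U, y ≠ 0 := fun y hy h0 ↦ by
    obtain ⟨i, -, hy'⟩ := Finset.mem_biUnion.1 hy
    obtain ⟨x, hx, rfl⟩ := Finset.mem_image.1 hy'
    rw [map_eq_zero_iff _ (halfTurn i).injective] at h0
    exact hF (h0 ▸ hx)
  have hFU0 : ∀ y : ↥(F ∪ U), ∃ j, (y : EucSp 3) j ≠ 0 := fun y ↦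
    exists_ne_zero_coord (by
      rcases Finset.mem_union.1 y.2 with h | h
      · exact fun h0 ↦ hF (h0 ▸ h)
      · exact hU0 _ h)
  choose c hc using hFU0
  obtain ⟨f, hf⟩ := Module.exists_dual_forall_apply_ne_zero (K := ℚ)
    (fun y : ↥(F ∪ U) ↦ (y : EucSp 3) (c y)) hc
  choose N k hN hk using fun x : EucSp 3 ↦ exists_int_smul fun j ↦ f (x j)
  have hk0 : ∀ y ∈ F ∪ U, k y ≠ 0 := fun y hy h0 ↦ by
    have h1 := hk y (c ⟨y, hy⟩)
    rw [h0, Pi.zero_apply, Int.cast_zero] at h1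
    exact mul_ne_zero (Int.cast_ne_zero.2 (hN y)) (hf ⟨y, hy⟩) h1.symm
  have hturn : ∀ i x, (5 * N x) • k (halfTurn i x) = N (halfTurn i x) • turn i (k x) :=
      fun i x ↦ by
    ext j
    have h1 : (5 : ℚ) * f (halfTurn i x j) = ∑ l, turnMatrix i j l * f (x l) := by
      have h2 := congrArg f (five_mul_halfTurn i x j)
      rw [turn_apply, map_sum] at h2
      have h3 : f (5 * halfTurn i x j) = 5 * f (halfTurn i x j) := by
        have := f.map_smul 5 (halfTurn i x j)
        rwa [smul_eq_mul, show (5 : ℚ) • halfTurn i x j = 5 * halfTurn i x j by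
          simp [Rat.smul_def]] at this
      rw [← h3, h2]
      exact Finset.sum_congr rfl fun l _ ↦ by rw [map_zsmul, zsmul_eq_mul]
    have h4 : ((((5 * N x) • k (halfTurn i x)) j : ℤ) : ℚ) =
        ((N (halfTurn i x) • turn i (k x)) j : ℤ) := by
      simp only [Pi.smul_apply, smul_eq_mul, turn_apply, Int.cast_mul, Int.cast_sum, hk,
        Int.cast_ofNat]
      calc (5 * N x * (N (halfTurn i x) * f (halfTurn i x j)) : ℚ)
          = N x * N (halfTurn i x) * (5 * f (halfTurn i x j)) := by ring
        _ = _ := by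
          rw [h1, Finset.mul_sum, Finset.mul_sum]
          exact Finset.sum_congr rfl fun l _ ↦ by ring
    exact_mod_cast h4
  have h1 : ∀ i, (F.filter fun x ↦ ¬ IsPerp i (k x)).card ≤
      (U.filter fun y ↦ IsPar i (k y)).card := fun i ↦ by
    refine Finset.card_le_card_of_injOn (halfTurn i) (fun x hx ↦ ?_) (halfTurn i).injective.injOn
    obtain ⟨hx, hxp⟩ := Finset.mem_filter.1 hx
    refine Finset.mem_coe.2 (Finset.mem_filter.2
      ⟨Finset.mem_biUnion.2 ⟨i, Finset.mem_univ _, Finset.mem_image_of_mem _ hx⟩, ?_⟩)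
    exact isPar_of_smul_eq (mul_ne_zero (by norm_num) (hN x)) (hN _)
      (hk0 x (Finset.mem_union_left _ hx)) (hturn i x) hxp
  have h2 : ∀ x ∈ F, 4 ≤ (Finset.univ.filter fun i ↦ ¬ IsPerp i (k x)).card := fun x hx ↦ by
    have h3 := card_isPerp_le (hk0 x (Finset.mem_union_left _ hx))
    have h4 := Finset.card_filter_add_card_filter_not (s := (Finset.univ : Finset (Fin 6)))
      (fun i ↦ IsPerp i (k x))
    rw [Finset.card_univ, Fintype.card_fin] at h4
    lia
  calc 4 * F.card = F.card * 4 := mul_comm _ _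
    _ ≤ ∑ x ∈ F, (Finset.univ.filter fun i ↦ ¬ IsPerp i (k x)).card :=
      Finset.card_nsmul_le_sum _ _ _ h2
    _ = ∑ i, (F.filter fun x ↦ ¬ IsPerp i (k x)).card :=
      Finset.sum_card_bipartiteAbove_eq_sum_card_bipartiteBelow fun x i ↦ ¬ IsPerp i (k x)
    _ ≤ ∑ i, (U.filter fun y ↦ IsPar i (k y)).card := Finset.sum_le_sum fun i _ ↦ h1 i
    _ = ∑ y ∈ U, (Finset.univ.filter fun i ↦ IsPar i (k y)).card :=
      (Finset.sum_card_bipartiteAbove_eq_sum_card_bipartiteBelow fun y i ↦ IsPar i (k y)).symm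
    _ ≤ U.card * 1 := Finset.sum_le_card_nsmul _ _ _ fun y hy ↦
      card_isPar_le (hk0 y (Finset.mem_union_right _ hy))
    _ = U.card := mul_one _

open Classical in
lemma exists_linearIsometryEquiv_expanding (n : ℕ) :
    ∃ S : Finset (EucSp 3 ≃ₗᵢ[ℝ] EucSp 3), ∀ F : Finset (EucSp 3), 0 ∉ F →
      4 ^ n * F.card ≤ (S.biUnion fun s ↦ F.image s).card := by
  induction n with
  | zero => exact ⟨{1}, fun F _ ↦ by simp⟩
  | succ n ih =>
    obtain ⟨S, hS⟩ := ih
    refine ⟨Finset.univ.biUnion fun i ↦ S.image fun s ↦ halfTurn i * s, fun F hF ↦ ?_⟩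
    have h0 : 0 ∉ S.biUnion fun s ↦ F.image s := fun h ↦ by
      obtain ⟨s, -, hs⟩ := Finset.mem_biUnion.1 h
      obtain ⟨x, hx, hx0⟩ := Finset.mem_image.1 hs
      rw [map_eq_zero_iff _ s.injective] at hx0
      exact hF (hx0 ▸ hx)
    calc 4 ^ (n + 1) * F.card = 4 * (4 ^ n * F.card) := by ring
      _ ≤ 4 * (S.biUnion fun s ↦ F.image s).card := by gcongr; exact hS F hF
      _ ≤ _ := four_mul_card_le_card_biUnion_halfTurn _ h0
      _ ≤ _ := Finset.card_le_card fun z hz ↦ by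
        obtain ⟨i, -, hz'⟩ := Finset.mem_biUnion.1 hz
        obtain ⟨y, hy, rfl⟩ := Finset.mem_image.1 hz'
        obtain ⟨s, hs, hy'⟩ := Finset.mem_biUnion.1 hy
        obtain ⟨x, hx, rfl⟩ := Finset.mem_image.1 hy'
        refine Finset.mem_biUnion.2 ⟨halfTurn i * s, ?_, Finset.mem_image.2 ⟨x, hx, rfl⟩⟩
        exact Finset.mem_biUnion.2 ⟨i, Finset.mem_univ _, Finset.mem_image_of_mem _ hs⟩

/-- A bounded set embeds piecewise isometrically in every set with nonempty interior. -/
lemma exists_injective_isometryEquiv {A B : Set (EucSp 3)} (hA : Bornology.IsBounded A)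
    (hB : (interior B).Nonempty) :
    ∃ (T : Set (EucSp 3 ≃ᵢ EucSp 3)) (f : A → B), T.Finite ∧ Function.Injective f ∧
      ∀ x : A, ∃ t ∈ T, t x = f x := by
  classical
  obtain ⟨c, hc⟩ := hB
  obtain ⟨r, hr, hrB⟩ := Metric.isOpen_iff.1 isOpen_interior c hc
  have hV : (interior (Metric.ball (0 : EucSp 3) r \ {0})).Nonempty := by
    rw [(Metric.isOpen_ball.sdiff isClosed_singleton).interior_eq]
    obtain ⟨x, hx⟩ := exists_norm_eq (EucSp 3) (show 0 ≤ r / 2 by positivity)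
    refine ⟨x, by rw [mem_ball_zero_iff, hx]; linarith, fun h0 ↦ ?_⟩
    rw [mem_singleton_iff.1 h0, norm_zero] at hx
    linarith
  obtain ⟨G, hG⟩ := exists_subset_smear hA hV
  obtain ⟨S, hS⟩ := exists_linearIsometryEquiv_expanding G.card
  let T : Finset (EucSp 3 ≃ᵢ EucSp 3) := (G ×ˢ S).image fun p ↦
    IsometryEquiv.addRight c * p.2.toIsometryEquiv * p.1⁻¹
  let t : A → Finset B := fun x ↦ (T.image fun s ↦ s x).subtype (· ∈ B)
  have hall : ∀ F : Finset A, F.card ≤ (F.biUnion t).card := fun F ↦ by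
    let D : (EucSp 3 ≃ᵢ EucSp 3) → Finset (EucSp 3) := fun g ↦
      (F.image fun x : A ↦ g⁻¹ x).filter (· ∈ Metric.ball (0 : EucSp 3) r \ {0})
    have h1 : ∀ g ∈ G, 4 ^ G.card * (D g).card ≤ (F.biUnion t).card := fun g hg ↦ by
      refine (hS (D g) fun h ↦ (Finset.mem_filter.1 h).2.2 rfl).trans ?_
      rw [← Finset.card_image_of_injective (F.biUnion t) Subtype.val_injective,
        ← Finset.card_image_of_injective _ (add_left_injective c)]
      refine Finset.card_le_card fun z hz ↦ ?_
      obtain ⟨y, hy, rfl⟩ := Finset.mem_image.1 hz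
      obtain ⟨s, hs, hy'⟩ := Finset.mem_biUnion.1 hy
      obtain ⟨w, hw, rfl⟩ := Finset.mem_image.1 hy'
      obtain ⟨hw, hwV⟩ := Finset.mem_filter.1 hw
      obtain ⟨x, hx, rfl⟩ := Finset.mem_image.1 hw
      have hB' : s (g⁻¹ x) + c ∈ B := interior_subset (hrB (by
        rw [mem_ball_iff_norm, add_sub_cancel_right, s.norm_map]
        exact mem_ball_zero_iff.1 hwV.1))
      refine Finset.mem_image.2 ⟨⟨_, hB'⟩, Finset.mem_biUnion.2 ⟨x, hx, ?_⟩, rfl⟩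
      exact Finset.mem_subtype.2 (Finset.mem_image.2 ⟨_, Finset.mem_image.2
        ⟨(g, s), Finset.mem_product.2 ⟨hg, hs⟩, rfl⟩, rfl⟩)
    have h2 : F.card ≤ ∑ g ∈ G, (D g).card := by
      have h3 : F.image Subtype.val ⊆ G.biUnion fun g ↦ (D g).image g := fun z hz ↦ by
        obtain ⟨x, hx, rfl⟩ := Finset.mem_image.1 hz
        obtain ⟨g, hg, v, hv, hgv⟩ := mem_smear.1 (hG x.2)
        refine Finset.mem_biUnion.2 ⟨g, hg, Finset.mem_image.2 ⟨v, ?_, hgv⟩⟩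
        exact Finset.mem_filter.2 ⟨Finset.mem_image.2 ⟨x, hx, by rw [← hgv]; simp⟩, hv⟩
      calc F.card = (F.image Subtype.val).card :=
            (Finset.card_image_of_injective _ Subtype.val_injective).symm
        _ ≤ _ := Finset.card_le_card h3
        _ ≤ ∑ g ∈ G, ((D g).image g).card := Finset.card_biUnion_le
        _ ≤ _ := Finset.sum_le_sum fun g _ ↦ Finset.card_image_le
    have h3 : G.card < 4 ^ G.card := Nat.lt_pow_self (by norm_num)
    refine le_of_mul_le_mul_left (a := 4 ^ G.card) ?_ (by positivity)
    calc 4 ^ G.card * F.card ≤ 4 ^ G.card * ∑ g ∈ G, (D g).card := by gcongr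
      _ = ∑ g ∈ G, 4 ^ G.card * (D g).card := Finset.mul_sum _ _ _
      _ ≤ G.card • (F.biUnion t).card := Finset.sum_le_card_nsmul _ _ _ h1
      _ ≤ 4 ^ G.card * (F.biUnion t).card := by rw [smul_eq_mul]; gcongr
  obtain ⟨f, hf, hft⟩ := (Finset.all_card_le_biUnion_card_iff_exists_injective t).1 hall
  refine ⟨T, f, T.finite_toSet, hf, fun x ↦ ?_⟩
  obtain ⟨s, hs, hsx⟩ := Finset.mem_image.1 (Finset.mem_subtype.1 (hft x))
  exact ⟨s, hs, hsx⟩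

/-- The strong form of the **Banach-Tarski paradox**, in terms of bijections. -/
lemma exists_bijective_isometryEquiv {A B : Set (EucSp 3)} (hA : Bornology.IsBounded A)
    (hB : Bornology.IsBounded B) (hAi : (interior A).Nonempty) (hBi : (interior B).Nonempty) :
    ∃ (T : Set (EucSp 3 ≃ᵢ EucSp 3)) (f : A → B), T.Finite ∧ Function.Bijective f ∧
      ∀ x : A, ∃ t ∈ T, t x = f x := by
  obtain ⟨T₁, f, hT₁, hf, hfT⟩ := exists_injective_isometryEquiv hA hBi
  obtain ⟨T₂, g, hT₂, hg, hgT⟩ := exists_injective_isometryEquiv hB hAi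
  obtain ⟨h, hh, hhT⟩ := Function.Embedding.schroeder_bernstein_of_rel hf hg
    (fun x y ↦ ∃ t ∈ T₁ ∪ (fun t ↦ t⁻¹) '' T₂, t (x : EucSp 3) = y)
    (fun x ↦ by
      obtain ⟨t, ht, htx⟩ := hfT x
      exact ⟨t, .inl ht, htx⟩)
    (fun y ↦ by
      obtain ⟨t, ht, hty⟩ := hgT y
      exact ⟨t⁻¹, .inr ⟨t, ht, rfl⟩, by rw [← hty, IsometryEquiv.inv_apply_self]⟩)
  exact ⟨_, h, hT₁.union (hT₂.image _), hh, hhT⟩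

end Expansion

section Assembly

lemma exists_null_invariant {T : Set (EucSp 3 ≃ᵢ EucSp 3)} (hT : T.Countable)
    {Z : Set (EucSp 3)} (hZ : volume Z = 0) :
    ∃ N, Z ⊆ N ∧ volume N = 0 ∧ ∀ t ∈ T, ∀ x, t x ∈ N ↔ x ∈ N := by
  have : Countable T := hT.to_subtype
  have : Countable (FreeGroup T) := Quot.mk_surjective.countable
  let φ : FreeGroup T →* (EucSp 3 ≃ᵢ EucSp 3) := FreeGroup.lift Subtype.val
  have hN : ∀ w, ∀ x ∈ ⋃ w, φ w '' Z, φ w x ∈ ⋃ w, φ w '' Z := fun w x hx ↦ by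
    obtain ⟨v, z, hz, rfl⟩ := mem_iUnion.1 hx
    exact mem_iUnion.2 ⟨w * v, z, hz, by rw [map_mul, IsometryEquiv.mul_apply]⟩
  refine ⟨⋃ w, φ w '' Z, fun z hz ↦ mem_iUnion.2 ⟨1, z, hz, by simp⟩,
    measure_iUnion_null fun w ↦ by rwa [measure_image_isometryEquiv], fun t ht x ↦ ?_⟩
  have h1 : φ (FreeGroup.of ⟨t, ht⟩) = t := FreeGroup.lift_apply_of
  refine ⟨fun h ↦ ?_, fun h ↦ ?_⟩
  · have := hN (FreeGroup.of ⟨t, ht⟩)⁻¹ _ h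
    rwa [map_inv, h1, IsometryEquiv.inv_apply_self] at this
  · have := hN (FreeGroup.of ⟨t, ht⟩) _ h
    rwa [h1] at this

lemma MeasurablyEquidecomposable.of_bijOn {n : ℕ} {A B : Set (EucSp n)}
    {T : Set (EucSp n ≃ᵢ EucSp n)} (hT : T.Finite) {l : EucSp n → EucSp n ≃ᵢ EucSp n}
    (hl : ∀ x ∈ A, l x ∈ T) (hbij : BijOn (fun x ↦ l x x) A B)
    (hmeas : ∀ t ∈ T, NullMeasurableSet {x | x ∈ A ∧ l x = t} volume) :
    MeasurablyEquidecomposable n A B := by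
  have := hT.to_subtype
  obtain ⟨m, ⟨e⟩⟩ := Finite.exists_equiv_fin T
  refine ⟨m, fun i ↦ e.symm i, fun i ↦ {x | x ∈ A ∧ l x = e.symm i}, fun i ↦ hmeas _ (e.symm i).2,
    fun i j hij ↦ ?_, ?_, fun i j hij ↦ ?_, ?_⟩
  · refine disjoint_left.2 fun x hx hx' ↦ hij (e.symm.injective (Subtype.ext ?_))
    exact hx.2.symm.trans hx'.2
  · ext x
    simp only [mem_iUnion]
    exact ⟨fun ⟨i, hi⟩ ↦ hi.1, fun hx ↦ ⟨e ⟨l x, hl x hx⟩, hx, by rw [e.symm_apply_apply]⟩⟩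
  · refine disjoint_left.2 ?_
    rintro _ ⟨x, hx, rfl⟩ ⟨y, hy, hxy⟩
    have : x = y := hbij.injOn hx.1 hy.1 (by
      rw [hx.2, hy.2, hxy])
    subst this
    exact hij (e.symm.injective (Subtype.ext (hx.2.symm.trans hy.2)))
  · ext y
    simp only [mem_iUnion]
    constructor
    · rintro ⟨i, x, hx, rfl⟩
      rw [← hx.2]
      exact hbij.mapsTo hx.1
    · intro hy
      obtain ⟨x, hx, rfl⟩ := hbij.surjOn hy
      exact ⟨e ⟨l x, hl x hx⟩, x, ⟨hx, by rw [e.symm_apply_apply]⟩, by rw [e.symm_apply_apply]⟩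

/-- Bounded measurable sets with nonempty interior and the same volume are measurably
equidecomposable. -/
theorem measurablyEquidecomposable_of_volume_eq {A B : Set (EucSp 3)}
    (hA : Bornology.IsBounded A) (hB : Bornology.IsBounded B) (hAm : MeasurableSet A)
    (hBm : MeasurableSet B) (hAi : (interior A).Nonempty) (hBi : (interior B).Nonempty)
    (hAB : volume A = volume B) : MeasurablyEquidecomposable 3 A B := by
  classical
  obtain ⟨T₁, hT₁, hexp⟩ := exists_finite_isExpanding hA hB hAm hBm hAi hBi hAB
  have := hT₁.to_subtype
  obtain ⟨m, hm, hm0⟩ := hexp.exists_matching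
  have hm0' := (hexp.measureReal_unmatched_right hm).trans hm0
  obtain ⟨T₂, f, hT₂, hf, hfT⟩ := exists_bijective_isometryEquiv hA hB hAi hBi
  choose s hs hsf using hfT
  set γ : T₁ → EucSp 3 ≃ᵐ EucSp 3 := fun t ↦ isometryMeasurableEquiv t
  have hZ : volume (A \ matchedSet m ∪ B \ matchedImage γ m) = 0 := by
    refine measure_union_null ?_ ?_
    · rwa [measureReal_eq_zero_iff
        (ne_top_of_le_ne_top hA.measure_lt_top.ne (measure_mono sdiff_subset))] at hm0
    · rwa [measureReal_eq_zero_iff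
        (ne_top_of_le_ne_top hB.measure_lt_top.ne (measure_mono sdiff_subset))] at hm0'
  obtain ⟨N, hZN, hN, hNT⟩ := exists_null_invariant (hT₁.union hT₂).countable hZ
  let l : EucSp 3 → EucSp 3 ≃ᵢ EucSp 3 := fun x ↦
    if h : x ∈ A ∧ x ∈ N then s ⟨x, h.1⟩ else (m x).elim 1 Subtype.val
  have hlN : ∀ {x} (hx : x ∈ A), x ∈ N → l x = s ⟨x, hx⟩ := fun hx hxN ↦ dif_pos ⟨hx, hxN⟩
  have hlm : ∀ {x i}, x ∉ N → m x = some i → l x = i := fun {x i} hxN hi ↦ by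
    have : l x = (m x).elim 1 Subtype.val := dif_neg fun h ↦ hxN h.2
    rw [this, hi, Option.elim_some]
  have hmx : ∀ {x}, x ∈ A → x ∉ N → ∃ i, m x = some i := fun {x} hx hxN ↦ by
    by_contra h
    exact hxN (hZN (.inl ⟨hx, mt mem_matchedSet.1 h⟩))
  have hlT : ∀ x ∈ A, l x ∈ T₁ ∪ T₂ := fun x hx ↦ by
    by_cases hxN : x ∈ N
    · rw [hlN hx hxN]
      exact .inr (hs _)
    · obtain ⟨i, hi⟩ := hmx hx hxN
      rw [hlm hxN hi]
      exact .inl i.2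
  have hlinv : ∀ x ∈ A, (l x x ∈ N ↔ x ∈ N) := fun x hx ↦ hNT _ (hlT x hx) x
  refine .of_bijOn (hT₁.union hT₂) hlT ⟨fun x hx ↦ ?_, fun x hx y hy hxy ↦ ?_, fun y hy ↦ ?_⟩
    fun t ht ↦ ?_
  · change l x x ∈ B
    by_cases hxN : x ∈ N
    · rw [hlN hx hxN, hsf]
      exact (f _).2
    · obtain ⟨i, hi⟩ := hmx hx hxN
      rw [hlm hxN hi]
      exact (hm.mem hi).2
  · change l x x = l y y at hxy
    have hiff : x ∈ N ↔ y ∈ N := by rw [← hlinv x hx, ← hlinv y hy, hxy]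
    by_cases hxN : x ∈ N
    · rw [hlN hx hxN, hlN hy (hiff.1 hxN), hsf, hsf] at hxy
      exact congrArg Subtype.val (hf.1 (Subtype.ext hxy))
    · obtain ⟨i, hi⟩ := hmx hx hxN
      obtain ⟨j, hj⟩ := hmx hy (mt hiff.2 hxN)
      rw [hlm hxN hi, hlm (mt hiff.2 hxN) hj] at hxy
      exact hm.inj hi hj hxy
  · by_cases hyN : y ∈ N
    · obtain ⟨x, hx⟩ := hf.2 ⟨y, hy⟩
      have hxy : s x x = y := by rw [hsf, hx]
      have hxN : (x : EucSp 3) ∈ N := (hNT _ (.inr (hs x)) x).1 (by rwa [hxy])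
      refine ⟨x, x.2, ?_⟩
      change l x x = y
      rw [hlN x.2 hxN, hxy]
    · have : y ∈ matchedImage γ m := by
        by_contra h
        exact hyN (hZN (.inr ⟨hy, h⟩))
      obtain ⟨i, x, hi, hxy⟩ := mem_matchedImage.1 this
      have hxy' : (i : EucSp 3 ≃ᵢ EucSp 3) x = y := hxy
      have hxN : x ∉ N := fun h ↦ hyN (hxy' ▸ (hNT _ (.inl i.2) x).2 h)
      refine ⟨x, (hm.mem hi).1, ?_⟩
      change l x x = y
      rw [hlm hxN hi, hxy']
  · have hM : MeasurableSet (⋃ (i : T₁) (_ : (i : EucSp 3 ≃ᵢ EucSp 3) = t), {x | m x = some i}) :=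
      .iUnion fun i ↦ .iUnion fun _ ↦ hm.measurableSet_eq i
    refine hM.nullMeasurableSet.congr ?_
    filter_upwards [measure_eq_zero_iff_ae_notMem.1 hN] with x hxN
    refine propext ?_
    change x ∈ (⋃ (i : T₁) (_ : (i : EucSp 3 ≃ᵢ EucSp 3) = t), {x | m x = some i}) ↔
      x ∈ A ∧ l x = t
    simp only [mem_iUnion, exists_prop]
    constructor
    · rintro ⟨i, rfl, hi⟩
      exact ⟨(hm.mem hi).1, hlm hxN hi⟩
    · rintro ⟨hx, rfl⟩
      obtain ⟨i, hi⟩ := hmx hx hxN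
      exact ⟨i, (hlm hxN hi).symm, hi⟩

lemma IsCube.isCompact {C : Set (EucSp 3)} (hC : IsCube C) : IsCompact C := by
  obtain ⟨a, γ, -, rfl⟩ := hC
  refine IsCompact.image ?_ γ.continuous
  have h : {x : EucSp 3 | ∀ i, x i ∈ Icc (0 : ℝ) a} =
      EuclideanSpace.equiv (Fin 3) ℝ ⁻¹' Icc 0 fun _ ↦ a := by
    ext x
    exact forall_and
  rw [h]
  exact (EuclideanSpace.equiv (Fin 3) ℝ).toHomeomorph.isCompact_preimage.2 isCompact_Icc

lemma IsCube.interior_nonempty {C : Set (EucSp 3)} (hC : IsCube C) : (interior C).Nonempty := by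
  obtain ⟨a, γ, ha, rfl⟩ := hC
  have h := γ.toHomeomorph.image_interior {x : EucSp 3 | ∀ i, x i ∈ Icc (0 : ℝ) a}
  change γ '' _ = interior (γ '' _) at h
  rw [← h]
  refine Nonempty.image _ ?_
  refine ⟨WithLp.toLp 2 fun _ ↦ a / 2, interior_maximal (fun x hx j ↦ ?_) (isOpen_cube a) fun j ↦ ?_⟩
  · exact Ioo_subset_Icc_self (hx j)
  · exact ⟨half_pos ha, half_lt_self ha⟩

end Assembly

/-- A regular tetrahedron and a cube in `ℝ³` of the same volume are equidecomposable using
Lebesgue measurable pieces (the measurable version of Hilbert's third problem). -/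
theorem tetrahedron_cube_measurable_equidecomposition (T C : Set (EucSp 3))
    (hT : IsRegularTetrahedron T) (hC : IsCube C) (hvol : volume T = volume C) :
    MeasurablyEquidecomposable 3 T C := by
  obtain ⟨p, -, -, -, rfl⟩ := hT
  have hTc : IsCompact (convexHull ℝ (range p)) := (finite_range p).isCompact_convexHull ℝ
  have hTi : (interior (convexHull ℝ (range p))).Nonempty := by
    by_contra h
    have h0 : volume (convexHull ℝ (range p)) = 0 := by
      refine measure_mono_null ?_ ((convex_convexHull ℝ (range p)).addHaar_frontier volume)
      rw [frontier, not_nonempty_iff_eq_empty.1 h, sdiff_empty]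
      exact subset_closure
    exact (Measure.measure_pos_of_nonempty_interior volume hC.interior_nonempty).ne'
      (hvol ▸ h0)
  exact measurablyEquidecomposable_of_volume_eq hTc.isBounded hC.isCompact.isBounded
    hTc.measurableSet hC.isCompact.measurableSet hTi hC.interior_nonempty hvol
end
end

section
/- Let n ≥ 3. Let A, B ⊆ S^{n-1} be disjoint Lebesgue measurable sets with non-empty interiors and μ(A) = μ(B). Let T be a finite set of rotations with S^{n-1} = ⋃_{τ∈T} τ(A) = ⋃_{τ∈T} τ(B). Let η > 0 satisfy η < min(μ(A)/3, 1/(2|T|)), and let S be a finite symmetric set of rotations (S⁻¹ = S) such that μ(⋃_{γ∈S} γ(U)) ≥ min(1 − η, μ(U)/η) for every measurable U ⊆ S^{n-1}. Define R := {τ⁻¹γ : γ ∈ S, τ ∈ T} ∪ {γτ : γ ∈ S, τ ∈ T}. Then for every measurable set U ⊆ A one has μ(B ∩ ⋃_{γ∈R} γ(U)) ≥ min((2/3)·μ(A), 2·μ(U)), and for every measurable set U ⊆ B one has μ(A ∩ ⋃_{γ∈R} γ(U)) ≥ min((2/3)·μ(A), 2·μ(U)). -/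
open MeasureTheory Set Metric
open scoped ENNReal

noncomputable section

/-- The unit sphere `S^{n-1} ⊆ ℝⁿ`. -/
abbrev Sph (n : ℕ) : Type := Metric.sphere (0 : EucSp n) 1

/-- A linear isometry of `ℝⁿ` is a rotation (an element of `SO(n)`) if it has determinant `1`. -/
def IsRotation {n : ℕ} (γ : EucSp n ≃ₗᵢ[ℝ] EucSp n) : Prop :=
  LinearMap.det (γ.toLinearEquiv.toLinearMap) = 1

/-- The action of a linear isometry of `ℝⁿ` on the unit sphere `S^{n-1}`. -/
def rotateSphere {n : ℕ} (γ : EucSp n ≃ₗᵢ[ℝ] EucSp n) (x : Sph n) : Sph n :=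
  ⟨γ x, by
    have hx : ‖(x : EucSp n)‖ = 1 := by
      have h := x.2
      rwa [Metric.mem_sphere, dist_zero_right] at h
    rw [Metric.mem_sphere, dist_zero_right, γ.norm_map]
    exact hx⟩

theorem rotateSphere_trans {n : ℕ} (γ τ : EucSp n ≃ₗᵢ[ℝ] EucSp n) (x : Sph n) :
    rotateSphere (γ.trans τ) x = rotateSphere τ (rotateSphere γ x) := rfl

theorem rotateSphere_symm_apply {n : ℕ} (τ : EucSp n ≃ₗᵢ[ℝ] EucSp n) (x : Sph n) :
    rotateSphere τ (rotateSphere τ.symm x) = x :=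
  Subtype.ext (τ.apply_symm_apply x)

theorem rotateSphere_apply_symm {n : ℕ} (τ : EucSp n ≃ₗᵢ[ℝ] EucSp n) (x : Sph n) :
    rotateSphere τ.symm (rotateSphere τ x) = x :=
  Subtype.ext (τ.symm_apply_apply x)

/-- `τ(B ∩ τ⁻¹(V)) = V ∩ τ(B)`. -/
theorem image_rotateSphere_inter_symm {n : ℕ} (τ : EucSp n ≃ₗᵢ[ℝ] EucSp n) (B V : Set (Sph n)) :
    rotateSphere τ '' (B ∩ rotateSphere τ.symm '' V) = V ∩ rotateSphere τ '' B := by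
  ext y
  constructor
  · rintro ⟨_, ⟨hB, v, hv, rfl⟩, rfl⟩
    exact ⟨by rwa [rotateSphere_symm_apply], _, hB, rfl⟩
  · rintro ⟨hV, b, hb, rfl⟩
    exact ⟨b, ⟨hb, _, hV, rotateSphere_apply_symm τ b⟩, rfl⟩

/-- A set covered by `|T|` sets has a `1/|T|` fraction of its measure in one of them. -/
theorem exists_measure_le_card_mul_inter {α ι : Type*} [MeasurableSpace α] (μ : Measure α)
    (T : Finset ι) (hT : T.Nonempty) (C : ι → Set α) (hC : (⋃ τ ∈ T, C τ) = Set.univ)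
    (V : Set α) : ∃ τ ∈ T, μ V ≤ T.card * μ (V ∩ C τ) := by
  obtain ⟨τ, hτ, hmax⟩ := T.exists_max_image (fun τ => μ (V ∩ C τ)) hT
  refine ⟨τ, hτ, ?_⟩
  calc μ V = μ (⋃ τ ∈ T, V ∩ C τ) := by rw [← Set.inter_iUnion₂, hC, Set.inter_univ]
    _ ≤ ∑ τ ∈ T, μ (V ∩ C τ) := measure_biUnion_finset_le T _
    _ ≤ T.card * μ (V ∩ C τ) := by
      rw [← nsmul_eq_mul]
      exact Finset.sum_le_card_nsmul T _ _ hmax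

/-- In a probability space, a set of measure at least `1 - η` meets `B` in measure at least
`(2/3)·μ(B)` when `η < μ(B)/3`. -/
theorem two_thirds_measure_le_inter {α : Type*} [MeasurableSpace α] (μ : Measure α)
    [IsProbabilityMeasure μ] {B X : Set α} (hB : NullMeasurableSet B μ) {η : ℝ} (hη : 0 < η)
    (hηB : ENNReal.ofReal η < μ B / 3) (hX : ENNReal.ofReal (1 - η) ≤ μ X) :
    2 / 3 * μ B ≤ μ (B ∩ X) := by
  have hsplit := measureReal_inter_add_sdiff₀ (μ := μ) (s := X) hB
  have hdiff : μ.real (X \ B) ≤ μ.real Bᶜ := measureReal_mono (fun x hx => hx.2)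
  have hcompl := probReal_compl_eq_one_sub₀ (μ := μ) hB
  have hX' : 1 - η ≤ μ.real X := (ENNReal.ofReal_le_iff_le_toReal (measure_ne_top μ X)).1 hX
  have hηB' : η < μ.real B / 3 := by
    have h := (ENNReal.lt_ofReal_iff_toReal_lt ENNReal.ofReal_ne_top).1
      (show ENNReal.ofReal η < ENNReal.ofReal (μ.real B / 3) by
        rwa [ENNReal.ofReal_div_of_pos (by norm_num), ofReal_measureReal, ENNReal.ofReal_ofNat])
    rwa [ENNReal.toReal_ofReal hη.le] at h
  rw [Set.inter_comm X B] at hsplit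
  have hreal : 2 / 3 * μ.real B ≤ μ.real (B ∩ X) := by linarith
  have h := ENNReal.ofReal_le_ofReal hreal
  rwa [ENNReal.ofReal_mul (by norm_num), ENNReal.ofReal_div_of_pos (by norm_num),
    ofReal_measureReal, ofReal_measureReal, ENNReal.ofReal_ofNat, ENNReal.ofReal_ofNat] at h

/-- One-sided expansion: if finitely many rotates of `B` cover the sphere and `S(U)` is large, then
the translates of `S(U)` by inverses of the covering rotations meet `B` in a large set. -/
theorem min_le_measure_inter_biUnion_rotateSphere {n : ℕ}
    (μ : Measure (Sph n)) [IsProbabilityMeasure μ]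
    (hinv : ∀ γ : EucSp n ≃ₗᵢ[ℝ] EucSp n, IsRotation γ →
      ∀ U : Set (Sph n), μ (rotateSphere γ '' U) = μ U)
    {B : Set (Sph n)} (hB : NullMeasurableSet B μ)
    (T : Finset (EucSp n ≃ₗᵢ[ℝ] EucSp n)) (hTrot : ∀ τ ∈ T, IsRotation τ)
    (hTB : (⋃ τ ∈ T, rotateSphere τ '' B) = Set.univ)
    {η : ℝ} (hη : 0 < η) (hηB : ENNReal.ofReal η < μ B / 3)
    (hηT : ENNReal.ofReal η < ((2 * T.card : ℕ) : ℝ≥0∞)⁻¹)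
    (S : Finset (EucSp n ≃ₗᵢ[ℝ] EucSp n)) (U : Set (Sph n))
    (hSexp : μ (⋃ γ ∈ S, rotateSphere γ '' U) ≥
        min (ENNReal.ofReal (1 - η)) (μ U / ENNReal.ofReal η))
    (R : Set (EucSp n ≃ₗᵢ[ℝ] EucSp n)) (hR : ∀ γ ∈ S, ∀ τ ∈ T, γ.trans τ.symm ∈ R) :
    min (2 / 3 * μ B) (2 * μ U) ≤ μ (B ∩ ⋃ ρ ∈ R, rotateSphere ρ '' U) := by
  set V := ⋃ γ ∈ S, rotateSphere γ '' U
  have hT : T.Nonempty := by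
    rw [Finset.nonempty_iff_ne_empty]
    rintro rfl
    have : (Set.univ : Set (Sph n)).Nonempty := nonempty_of_measure_ne_zero (μ := μ) (by simp)
    simp [← hTB] at this
  have hsub : ∀ τ ∈ T, μ (V ∩ rotateSphere τ '' B) ≤ μ (B ∩ ⋃ ρ ∈ R, rotateSphere ρ '' U) := by
    intro τ hτ
    rw [← image_rotateSphere_inter_symm, hinv τ (hTrot τ hτ)]
    refine measure_mono (Set.inter_subset_inter_right _ ?_)
    rintro _ ⟨v, hv, rfl⟩
    obtain ⟨γ, hγ, u, hu, rfl⟩ := Set.mem_iUnion₂.1 hv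
    exact Set.mem_iUnion₂.2 ⟨_, hR γ hγ τ hτ, u, hu, rotateSphere_trans γ τ.symm u⟩
  rcases min_le_iff.1 hSexp with h | h
  · obtain ⟨τ, hτ⟩ := hT
    refine (min_le_left _ _).trans (le_trans ?_ (hsub τ hτ))
    have hBτ : μ (rotateSphere τ '' B) = μ B := hinv τ (hTrot τ hτ) B
    rw [← image_rotateSphere_inter_symm, hinv τ (hTrot τ hτ)]
    refine two_thirds_measure_le_inter μ hB hη hηB (h.trans_eq ?_)
    rw [← hinv τ (hTrot τ hτ) (rotateSphere τ.symm '' V), Set.image_image]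
    simp [rotateSphere_symm_apply]
  · obtain ⟨τ, hτ, hle⟩ := exists_measure_le_card_mul_inter μ T hT _ hTB V
    refine (min_le_right _ _).trans (le_trans ?_ (hsub τ hτ))
    have hcard : (T.card : ℝ≥0∞) ≠ 0 := by simpa using hT.ne_empty
    rw [← ENNReal.mul_le_mul_iff_right hcard (ENNReal.natCast_ne_top _)]
    refine le_trans ?_ (h.trans hle)
    have hinvη : ((2 * T.card : ℕ) : ℝ≥0∞) ≤ (ENNReal.ofReal η)⁻¹ :=
      ENNReal.le_inv_iff_le_inv.2 hηT.le
    calc (T.card : ℝ≥0∞) * (2 * μ U) = μ U * ((2 * T.card : ℕ) : ℝ≥0∞) := by push_cast; ring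
      _ ≤ μ U / ENNReal.ofReal η := by rw [div_eq_mul_inv]; gcongr

/-- Claim 1: under the covering and expansion assumptions, every measurable `U` contained in `A`
(resp. in `B`) has neighbourhood `N(U) = B ∩ ⋃_{ρ ∈ R} ρ(U)` (resp. `A ∩ ⋃_{ρ ∈ R} ρ(U)`) of
measure at least `min((2/3)·μ(A), 2·μ(U))`. -/
theorem neighbourhood_expansion_claim (n : ℕ) (hn : 3 ≤ n)
    (μ : Measure (Sph n)) [IsProbabilityMeasure μ]
    (hinv : ∀ γ : EucSp n ≃ₗᵢ[ℝ] EucSp n, IsRotation γ →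
      ∀ U : Set (Sph n), μ (rotateSphere γ '' U) = μ U)
    (A B : Set (Sph n)) (hdisj : Disjoint A B)
    (hAm : NullMeasurableSet A μ) (hBm : NullMeasurableSet B μ)
    (hAi : (interior A).Nonempty) (hBi : (interior B).Nonempty)
    (hAB : μ A = μ B)
    (T : Finset (EucSp n ≃ₗᵢ[ℝ] EucSp n)) (hTrot : ∀ τ ∈ T, IsRotation τ)
    (hTA : (⋃ τ ∈ T, rotateSphere τ '' A) = Set.univ)
    (hTB : (⋃ τ ∈ T, rotateSphere τ '' B) = Set.univ)
    (η : ℝ) (hη : 0 < η)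
    (hηA : ENNReal.ofReal η < μ A / 3)
    (hηT : ENNReal.ofReal η < ((2 * T.card : ℕ) : ℝ≥0∞)⁻¹)
    (S : Finset (EucSp n ≃ₗᵢ[ℝ] EucSp n)) (hSrot : ∀ γ ∈ S, IsRotation γ)
    (hSsymm : ∀ γ ∈ S, γ.symm ∈ S)
    (hSexp : ∀ U : Set (Sph n), NullMeasurableSet U μ →
      μ (⋃ γ ∈ S, rotateSphere γ '' U) ≥
        min (ENNReal.ofReal (1 - η)) (μ U / ENNReal.ofReal η))
    (R : Set (EucSp n ≃ₗᵢ[ℝ] EucSp n))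
    (hR : R = {ρ | ∃ γ ∈ S, ∃ τ ∈ T, ρ = γ.trans τ.symm} ∪
              {ρ | ∃ γ ∈ S, ∃ τ ∈ T, ρ = τ.trans γ}) :
    (∀ U ⊆ A, NullMeasurableSet U μ →
      μ (B ∩ ⋃ ρ ∈ R, rotateSphere ρ '' U) ≥ min (2 / 3 * μ A) (2 * μ U)) ∧
    (∀ U ⊆ B, NullMeasurableSet U μ →
      μ (A ∩ ⋃ ρ ∈ R, rotateSphere ρ '' U) ≥ min (2 / 3 * μ A) (2 * μ U)) := by
  have hmem : ∀ γ ∈ S, ∀ τ ∈ T, γ.trans τ.symm ∈ R := by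
    intro γ hγ τ hτ
    rw [hR]
    exact Or.inl ⟨γ, hγ, τ, hτ, rfl⟩
  constructor
  · intro U _ hU
    rw [hAB] at hηA ⊢
    exact min_le_measure_inter_biUnion_rotateSphere μ hinv hBm T hTrot hTB hη hηA hηT S U
      (hSexp U hU) R hmem
  · intro U _ hU
    exact min_le_measure_inter_biUnion_rotateSphere μ hinv hAm T hTrot hTA hη hηA hηT S U
      (hSexp U hU) R hmem
end
end

section
/- Let n ≥ 3. Let A, B ⊆ S^{n-1} be disjoint open sets with μ(A) = μ(B) > 0, let T be a finite set of rotations with S^{n-1} = ⋃_{τ∈T} τ(A) = ⋃_{τ∈T} τ(B), let η > 0 satisfy η < min(μ(A)/3, 1/(2|T|)), let S be a finite symmetric set of rotations such that μ(⋃_{γ∈S} γ(U)) ≥ min(1 − η, μ(U)/η) for every measurable U ⊆ S^{n-1}, and let R := {τ⁻¹γ : γ ∈ S, τ ∈ T} ∪ {γτ : γ ∈ S, τ ∈ T}. Then in the bipartite graph 𝒢 on A ∪ B (with an edge between x ∈ A and y ∈ B whenever γ(x) = y for some γ ∈ R), every finite set X of vertices contained entirely in A or entirely in B satisfies |N(X)|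 ≥ 2|X|, where N(X) denotes the set of neighbours of X in 𝒢. -/
open MeasureTheory Set Metric
open scoped ENNReal

noncomputable section

open Submodule in
theorem det_reflection_orthogonal_span_singleton {n : ℕ} {z : EucSp n} (hz : z ≠ 0) :
    LinearMap.det ((ℝ ∙ z)ᗮ.reflection.toLinearEquiv.toLinearMap) = -1 := by
  have h := Submodule.det_reflection (ℝ ∙ z)ᗮ
  rw [Submodule.orthogonal_orthogonal, finrank_span_singleton hz, pow_one] at h
  exact h

open Submodule in
/-- In dimension at least two, rotations act transitively on the unit sphere. -/
theorem exists_isRotation_rotateSphere_eq {n : ℕ} (hn : 2 ≤ n) (x y : Sph n) :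
    ∃ γ : EucSp n ≃ₗᵢ[ℝ] EucSp n, IsRotation γ ∧ rotateSphere γ x = y := by
  by_cases hxy : x = y
  · exact ⟨LinearIsometryEquiv.refl ℝ _, LinearMap.det_id, hxy⟩
  have hsub : (x : EucSp n) - y ≠ 0 := sub_ne_zero.2 fun h => hxy (Subtype.ext h)
  have hnorm : ‖(x : EucSp n)‖ = ‖(y : EucSp n)‖ := by
    rw [norm_eq_of_mem_sphere, norm_eq_of_mem_sphere]
  have hbot : (ℝ ∙ (y : EucSp n))ᗮ ≠ ⊥ := by
    intro h
    have hfin := Submodule.finrank_add_finrank_orthogonal (ℝ ∙ (y : EucSp n))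
    have hle := finrank_span_le_card (R := ℝ) ({(y : EucSp n)} : Set (EucSp n))
    rw [h, finrank_bot, finrank_euclideanSpace_fin] at hfin
    simp only [Set.toFinset_singleton, Finset.card_singleton] at hle
    omega
  obtain ⟨z, hzy, hz⟩ := Submodule.exists_mem_ne_zero_of_ne_bot hbot
  refine ⟨(ℝ ∙ ((x : EucSp n) - y))ᗮ.reflection.trans (ℝ ∙ z)ᗮ.reflection, ?_, ?_⟩
  · have h := LinearMap.det_comp ((ℝ ∙ z)ᗮ.reflection.toLinearEquiv.toLinearMap)
      ((ℝ ∙ ((x : EucSp n) - y))ᗮ.reflection.toLinearEquiv.toLinearMap)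
    rw [det_reflection_orthogonal_span_singleton hz,
      det_reflection_orthogonal_span_singleton hsub, neg_one_mul, neg_neg] at h
    exact h
  · apply Subtype.ext
    change (ℝ ∙ z)ᗮ.reflection ((ℝ ∙ ((x : EucSp n) - y))ᗮ.reflection x) = y
    rw [reflection_sub hnorm, reflection_mem_subspace_eq_self]
    rw [Submodule.mem_orthogonal_singleton_iff_inner_right]
    exact (Submodule.mem_orthogonal_singleton_iff_inner_left.1 hzy)

theorem rotateSphere_image_ball_subset {n : ℕ} (γ : EucSp n ≃ₗᵢ[ℝ] EucSp n) (x : Sph n)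
    (ε : ℝ) : rotateSphere γ '' ball x ε ⊆ ball (rotateSphere γ x) ε := by
  rintro _ ⟨y, hy, rfl⟩
  rw [mem_ball, Subtype.dist_eq] at hy ⊢
  exact (γ.dist_map (y : EucSp n) x).trans_lt hy

theorem infinite_sphere {n : ℕ} (hn : 2 ≤ n) : Infinite (Sph n) := by
  have hrank : 1 < Module.rank ℝ (EucSp n) := by
    rw [← Module.finrank_eq_rank, finrank_euclideanSpace_fin]
    exact_mod_cast hn
  have : Nontrivial (EucSp n) := rank_pos_iff_nontrivial.1 (zero_lt_one.trans hrank)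
  have hconn := isConnected_sphere hrank (0 : EucSp n) zero_le_one
  obtain ⟨x, hx⟩ := hconn.nonempty
  refine (hconn.isPreconnected.infinite_of_nontrivial
    ⟨x, hx, -x, by simpa using hx, fun h => ?_⟩).to_subtype
  have h2 : (2 : ℝ) • x = 0 := by rw [two_smul, ← eq_neg_iff_add_eq_zero, ← h]
  exact ne_zero_of_mem_unit_sphere ⟨x, hx⟩ ((smul_eq_zero.1 h2).resolve_left two_ne_zero)

section Invariant

variable {n : ℕ} {μ : Measure (Sph n)}

theorem measure_ball_eq_of_invariant (hn : 2 ≤ n)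
    (hinv : ∀ γ : EucSp n ≃ₗᵢ[ℝ] EucSp n, IsRotation γ →
      ∀ U : Set (Sph n), μ (rotateSphere γ '' U) = μ U) (x y : Sph n) (ε : ℝ) :
    μ (ball x ε) = μ (ball y ε) := by
  have hle : ∀ x y : Sph n, μ (ball x ε) ≤ μ (ball y ε) := by
    intro x y
    obtain ⟨γ, hγ, rfl⟩ := exists_isRotation_rotateSphere_eq hn x y
    rw [← hinv γ hγ]
    exact measure_mono (rotateSphere_image_ball_subset γ x ε)
  exact (hle x y).antisymm (hle y x)

theorem measure_ball_pos_of_invariant [IsProbabilityMeasure μ] (hn : 2 ≤ n)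
    (hinv : ∀ γ : EucSp n ≃ₗᵢ[ℝ] EucSp n, IsRotation γ →
      ∀ U : Set (Sph n), μ (rotateSphere γ '' U) = μ U) (x : Sph n) {ε : ℝ} (hε : 0 < ε) :
    0 < μ (ball x ε) := by
  rw [pos_iff_ne_zero]
  intro h
  have huniv : μ Set.univ = 0 := measure_null_of_locally_null _ fun y _ =>
    ⟨ball y ε, mem_nhdsWithin_of_mem_nhds (ball_mem_nhds y hε),
      (measure_ball_eq_of_invariant hn hinv y x ε).trans h⟩
  simp at huniv

/-- A finite set of points of a metric space is separated by balls of a common radius. -/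
theorem Finset.exists_pairwiseDisjoint_ball {α : Type*} [MetricSpace α] (F : Finset α) :
    ∃ ε : ℝ, 0 < ε ∧ (F : Set α).PairwiseDisjoint fun x => ball x ε := by
  by_cases hF : (F : Set α).Nontrivial
  · refine ⟨(F : Set α).infsep / 2, half_pos (F.finite_toSet.infsep_pos_iff_nontrivial.2 hF), ?_⟩
    intro x hx y hy hxy
    apply ball_disjoint_ball
    rw [add_halves]
    exact infsep_le_dist_of_mem hx hy hxy
  · exact ⟨1, one_pos, (Set.not_nontrivial_iff.1 hF).pairwise _⟩

/-- Expansion of measurable sets under a finite set of rotations passes to finite sets. -/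
theorem card_div_le_ncard_of_expansion [IsProbabilityMeasure μ] (hn : 2 ≤ n)
    (hinv : ∀ γ : EucSp n ≃ₗᵢ[ℝ] EucSp n, IsRotation γ →
      ∀ U : Set (Sph n), μ (rotateSphere γ '' U) = μ U)
    {η : ℝ} (hη : 0 < η) (hη1 : η < 1) (S : Finset (EucSp n ≃ₗᵢ[ℝ] EucSp n))
    (hSexp : ∀ U : Set (Sph n), NullMeasurableSet U μ →
      μ (⋃ γ ∈ S, rotateSphere γ '' U) ≥
        min (ENNReal.ofReal (1 - η)) (μ U / ENNReal.ofReal η)) (X : Finset (Sph n)) :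
    (X.card : ℝ) / η ≤ (⋃ γ ∈ S, rotateSphere γ '' (X : Set (Sph n))).ncard := by
  classical
  have hYfin : (⋃ γ ∈ S, rotateSphere γ '' (X : Set (Sph n))).Finite :=
    S.finite_toSet.biUnion fun γ _ => X.finite_toSet.image _
  have hinf := infinite_sphere hn
  obtain ⟨k, hk⟩ := exists_nat_gt ((X.card : ℝ) / η / (1 - η))
  obtain ⟨F, hXF, hF⟩ := Infinite.exists_superset_card_eq X (X.card + k) (Nat.le_add_right _ _)
  obtain ⟨ε, hε, hdisj⟩ := F.exists_pairwiseDisjoint_ball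
  obtain ⟨o⟩ : Nonempty (Sph n) := inferInstance
  set m : ℝ := μ.real (ball o ε) with hm
  have hmeas (x : Sph n) : μ.real (ball x ε) = m := by
    rw [hm, measureReal_def, measureReal_def, measure_ball_eq_of_invariant hn hinv x o]
  have hmpos : 0 < m :=
    ENNReal.toReal_pos (measure_ball_pos_of_invariant hn hinv o hε).ne' (measure_ne_top _ _)
  have hunion (G : Finset (Sph n)) (hG : G ⊆ F) : μ.real (⋃ x ∈ G, ball x ε) = G.card * m := by
    rw [measureReal_biUnion_finset (hdisj.subset (Finset.coe_subset.2 hG))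
      fun _ _ => measurableSet_ball]
    simp [hmeas]
  have hFle : (F.card : ℝ) * m ≤ 1 := by
    rw [← hunion F subset_rfl]
    exact measureReal_le_one
  have hsmall : (X.card : ℝ) * m / η ≤ 1 - η := by
    rw [hF] at hFle
    push_cast at hFle
    rw [div_lt_iff₀ (by linarith)] at hk
    have h1 : (k : ℝ) * m ≤ 1 := by nlinarith [(Nat.cast_nonneg X.card : (0 : ℝ) ≤ X.card)]
    calc (X.card : ℝ) * m / η = X.card / η * m := by ring
      _ ≤ k * (1 - η) * m := by gcongr
      _ = (1 - η) * (k * m) := by ring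
      _ ≤ 1 - η := mul_le_of_le_one_right (by linarith) h1
  have hexp := hSexp (⋃ x ∈ X, ball x ε)
    (X.measurableSet_biUnion fun _ _ => measurableSet_ball).nullMeasurableSet
  rw [← ofReal_measureReal (measure_ne_top _ _), ← ofReal_measureReal (measure_ne_top _ _),
    ← ENNReal.ofReal_div_of_pos hη, hunion X hXF, min_eq_right (ENNReal.ofReal_le_ofReal hsmall),
    ge_iff_le, ENNReal.ofReal_le_ofReal_iff measureReal_nonneg] at hexp
  have hsub : (⋃ γ ∈ S, rotateSphere γ '' ⋃ x ∈ X, ball x ε) ⊆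
      ⋃ y ∈ hYfin.toFinset, ball y ε := by
    simp only [Set.iUnion_subset_iff, Set.image_iUnion]
    intro γ hγ x hx
    refine (rotateSphere_image_ball_subset γ x ε).trans
      (Set.subset_biUnion_of_mem (u := fun y => ball y ε) ?_)
    simp only [SetLike.mem_coe, Set.Finite.mem_toFinset, Set.mem_iUnion]
    exact ⟨γ, hγ, x, hx, rfl⟩
  have hupper := (measureReal_mono (μ := μ) hsub (measure_ne_top _ _)).trans
    (measureReal_biUnion_finset_le _ _)
  simp only [hmeas, Finset.sum_const, nsmul_eq_mul] at hupper
  rw [Set.ncard_eq_toFinset_card _ hYfin]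
  refine le_of_mul_le_mul_right ?_ hmpos
  rw [div_mul_eq_mul_div]
  exact hexp.trans hupper

end Invariant

/-- If the translates of `C` by `T` cover the sphere and every point of `C` of the form
`τ⁻¹ y` with `y ∈ Y` and `τ ∈ T` lies in `N`, then `|Y| ≤ |T| |N|`. -/
theorem ncard_le_card_mul_ncard_of_cover {n : ℕ} {C Y N : Set (Sph n)}
    (T : Finset (EucSp n ≃ₗᵢ[ℝ] EucSp n)) (hT : (⋃ τ ∈ T, rotateSphere τ '' C) = Set.univ)
    (hN : N.Finite) (hYN : ∀ τ ∈ T, ∀ c ∈ C, rotateSphere τ c ∈ Y → c ∈ N) :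
    Y.ncard ≤ T.card * N.ncard := by
  classical
  have hsub : Y ⊆ T.biUnion fun τ => hN.toFinset.image (rotateSphere τ) := by
    intro y hy
    have hmem : y ∈ ⋃ τ ∈ T, rotateSphere τ '' C := hT ▸ Set.mem_univ y
    simp only [Set.mem_iUnion] at hmem
    obtain ⟨τ, hτ, c, hc, rfl⟩ := hmem
    simp only [Finset.mem_coe, Finset.mem_biUnion, Finset.mem_image, Set.Finite.mem_toFinset]
    exact ⟨τ, hτ, c, hYN τ hτ c hc hy, rfl⟩
  calc Y.ncard ≤ (T.biUnion fun τ => hN.toFinset.image (rotateSphere τ)).card := by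
        rw [← Set.ncard_coe_finset]
        exact Set.ncard_le_ncard hsub (Finset.finite_toSet _)
    _ ≤ T.card * N.ncard := by
        refine Finset.card_biUnion_le_card_mul _ _ _ fun τ _ => ?_
        rw [Set.ncard_eq_toFinset_card _ hN]
        exact Finset.card_image_le

/-- Vertex expansion from a finite set `X` into a set `C` whose translates cover the sphere. -/
theorem two_mul_ncard_le_ncard_neighbors {n : ℕ} (hn : 2 ≤ n)
    {μ : Measure (Sph n)} [IsProbabilityMeasure μ]
    (hinv : ∀ γ : EucSp n ≃ₗᵢ[ℝ] EucSp n, IsRotation γ →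
      ∀ U : Set (Sph n), μ (rotateSphere γ '' U) = μ U)
    {C : Set (Sph n)} {T : Finset (EucSp n ≃ₗᵢ[ℝ] EucSp n)}
    (hTC : (⋃ τ ∈ T, rotateSphere τ '' C) = Set.univ)
    {η : ℝ} (hη : 0 < η) (hη1 : η < 1)
    (hηT : ENNReal.ofReal η < ((2 * T.card : ℕ) : ℝ≥0∞)⁻¹)
    {S : Finset (EucSp n ≃ₗᵢ[ℝ] EucSp n)}
    (hSexp : ∀ U : Set (Sph n), NullMeasurableSet U μ →
      μ (⋃ γ ∈ S, rotateSphere γ '' U) ≥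
        min (ENNReal.ofReal (1 - η)) (μ U / ENNReal.ofReal η))
    {R : Set (EucSp n ≃ₗᵢ[ℝ] EucSp n)} (hRfin : R.Finite)
    (hR : ∀ γ ∈ S, ∀ τ ∈ T, γ.trans τ.symm ∈ R) {X : Set (Sph n)} (hX : X.Finite) :
    {y | y ∈ C ∧ ∃ x ∈ X, ∃ ρ ∈ R, rotateSphere ρ x = y}.Finite ∧
      2 * X.ncard ≤ {y | y ∈ C ∧ ∃ x ∈ X, ∃ ρ ∈ R, rotateSphere ρ x = y}.ncard := by
  have hN : {y | y ∈ C ∧ ∃ x ∈ X, ∃ ρ ∈ R, rotateSphere ρ x = y}.Finite := by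
    refine (hX.biUnion fun x _ => hRfin.image fun ρ => rotateSphere ρ x).subset ?_
    rintro y ⟨-, x, hx, ρ, hρ, rfl⟩
    exact Set.mem_biUnion hx ⟨ρ, hρ, rfl⟩
  refine ⟨hN, ?_⟩
  have hTpos : 0 < T.card := by
    obtain ⟨o⟩ : Nonempty (Sph n) := (infinite_sphere hn).nonempty
    have hmem : o ∈ ⋃ τ ∈ T, rotateSphere τ '' C := hTC ▸ Set.mem_univ o
    simp only [Set.mem_iUnion] at hmem
    obtain ⟨τ, hτ, -⟩ := hmem
    exact Finset.card_pos.2 ⟨τ, hτ⟩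
  have hηT' : (2 * T.card : ℕ) < η⁻¹ := by
    rw [ENNReal.lt_inv_iff_lt_inv, ← ENNReal.ofReal_inv_of_pos hη, ← ENNReal.ofReal_natCast,
      ENNReal.ofReal_lt_ofReal_iff (inv_pos.2 hη)] at hηT
    exact hηT
  have hexp := card_div_le_ncard_of_expansion hn hinv hη hη1 S hSexp hX.toFinset
  rw [← Set.ncard_eq_toFinset_card _ hX, hX.coe_toFinset] at hexp
  have hlow : X.ncard * (2 * T.card) ≤ (⋃ γ ∈ S, rotateSphere γ '' X).ncard := by
    have h : (X.ncard : ℝ) * (2 * T.card : ℕ) ≤ X.ncard / η := by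
      rw [div_eq_mul_inv]
      gcongr
    exact_mod_cast h.trans hexp
  have hup := ncard_le_card_mul_ncard_of_cover (Y := ⋃ γ ∈ S, rotateSphere γ '' X) T hTC hN (by
    intro τ hτ c hc hcY
    simp only [Set.mem_iUnion] at hcY
    obtain ⟨γ, hγ, x, hx, hxc⟩ := hcY
    refine ⟨hc, x, hx, _, hR γ hγ τ hτ, Subtype.ext ?_⟩
    change τ.symm (γ x) = c
    rw [LinearIsometryEquiv.symm_apply_eq]
    exact congrArg Subtype.val hxc)
  refine Nat.le_of_mul_le_mul_left ?_ hTpos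
  linarith

/-- For disjoint open sets `A, B ⊆ S^{n-1}` of equal positive measure, with `T`, `η`, `S`, `R`
as in the paper, every finite set `X` of vertices of the bipartite graph `𝒢` on `A ∪ B`
contained entirely in `A` or entirely in `B` satisfies `|N(X)| ≥ 2|X|`. -/
theorem finite_vertex_expansion (n : ℕ) (hn : 3 ≤ n)
    (μ : Measure (Sph n)) [IsProbabilityMeasure μ]
    (hinv : ∀ γ : EucSp n ≃ₗᵢ[ℝ] EucSp n, IsRotation γ →
      ∀ U : Set (Sph n), μ (rotateSphere γ '' U) = μ U)
    (A B : Set (Sph n)) (hdisj : Disjoint A B)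
    (hAopen : IsOpen A) (hBopen : IsOpen B)
    (hAB : μ A = μ B) (hApos : 0 < μ A)
    (T : Finset (EucSp n ≃ₗᵢ[ℝ] EucSp n)) (hTrot : ∀ τ ∈ T, IsRotation τ)
    (hTA : (⋃ τ ∈ T, rotateSphere τ '' A) = Set.univ)
    (hTB : (⋃ τ ∈ T, rotateSphere τ '' B) = Set.univ)
    (η : ℝ) (hη : 0 < η)
    (hηA : ENNReal.ofReal η < μ A / 3)
    (hηT : ENNReal.ofReal η < ((2 * T.card : ℕ) : ℝ≥0∞)⁻¹)
    (S : Finset (EucSp n ≃ₗᵢ[ℝ] EucSp n)) (hSrot : ∀ γ ∈ S, IsRotation γ)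
    (hSsymm : ∀ γ ∈ S, γ.symm ∈ S)
    (hSexp : ∀ U : Set (Sph n), NullMeasurableSet U μ →
      μ (⋃ γ ∈ S, rotateSphere γ '' U) ≥
        min (ENNReal.ofReal (1 - η)) (μ U / ENNReal.ofReal η))
    (R : Set (EucSp n ≃ₗᵢ[ℝ] EucSp n))
    (hR : R = {ρ | ∃ γ ∈ S, ∃ τ ∈ T, ρ = γ.trans τ.symm} ∪
              {ρ | ∃ γ ∈ S, ∃ τ ∈ T, ρ = τ.trans γ}) :
    (∀ X : Set (Sph n), X.Finite → X ⊆ A →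
      {y | y ∈ B ∧ ∃ x ∈ X, ∃ ρ ∈ R, rotateSphere ρ x = y}.Finite ∧
      2 * X.ncard ≤ {y | y ∈ B ∧ ∃ x ∈ X, ∃ ρ ∈ R, rotateSphere ρ x = y}.ncard) ∧
    (∀ X : Set (Sph n), X.Finite → X ⊆ B →
      {y | y ∈ A ∧ ∃ x ∈ X, ∃ ρ ∈ R, rotateSphere ρ x = y}.Finite ∧
      2 * X.ncard ≤ {y | y ∈ A ∧ ∃ x ∈ X, ∃ ρ ∈ R, rotateSphere ρ x = y}.ncard) := by
  have hη1 : η < 1 := by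
    have h : ENNReal.ofReal η < 1 := hηA.trans_le <|
      ENNReal.div_le_of_le_mul (prob_le_one.trans (by norm_num))
    exact ENNReal.ofReal_lt_one.1 h
  have hRfin : R.Finite := by
    rw [hR]
    refine Set.Finite.union
      ((S.finite_toSet.image2 (fun γ τ => γ.trans τ.symm) T.finite_toSet).subset ?_)
      ((S.finite_toSet.image2 (fun γ τ => τ.trans γ) T.finite_toSet).subset ?_)
    · rintro ρ ⟨γ, hγ, τ, hτ, rfl⟩
      exact ⟨γ, hγ, τ, hτ, rfl⟩
    · rintro ρ ⟨γ, hγ, τ, hτ, rfl⟩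
      exact ⟨γ, hγ, τ, hτ, rfl⟩
  have hRmem : ∀ γ ∈ S, ∀ τ ∈ T, γ.trans τ.symm ∈ R := fun γ hγ τ hτ =>
    hR ▸ Or.inl ⟨γ, hγ, τ, hτ, rfl⟩
  have hn2 : 2 ≤ n := by omega
  exact ⟨fun X hX _ => two_mul_ncard_le_ncard_neighbors hn2 hinv hTB hη hη1 hηT hSexp hRfin
      hRmem hX,
    fun X hX _ => two_mul_ncard_le_ncard_neighbors hn2 hinv hTA hη hη1 hηT hSexp hRfin hRmem hX⟩
end
end
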